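/- arXiv:2312.01288 — 6 statements merged into one kernel-verified Lean document; each statement's English description precedes it below -/
import Mathlib

section
/- Kolmogorov–Arnold representation, existence form (Theorem 1 of the paper): for every integer N ≥ 1 and every continuous function c : [0,1]^N → ℝ, there exist an integer M ≥ 1, continuous functions u_m : ℝ → ℝ for m = 1,…,M, and continuous functions v_{m,i} : [0,1] → ℝ for m = 1,…,M and i = 1,…,N, such that c(a_1,…,a_N) = ∑_{m=1}^{M} u_m( ∑_{i=1}^{N} v_{m,i}(a_i) ) for all (a_1,…,a_N) ∈ [0,1]^N. -/
open Set Filter Topology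
open scoped BoundedContinuousFunction unitInterval

/-- If `f` oscillates by less than `ε` on each fibre of `w` inside a compact set `K`, then on `K`
it is `ε`-close to a function factoring through `w`. -/
theorem exists_comp_approx_of_fiber_oscillation_lt {X : Type*} [TopologicalSpace X] {K : Set X}
    (hK : IsCompact K) (w f : C(X, ℝ)) {ε B : ℝ} (hB : 0 ≤ B)
    (hf : ∀ x, |f x| ≤ B)
    (h : ∀ x ∈ K, ∀ y ∈ K, w x = w y → |f x - f y| < ε) :
    ∃ g : ℝ →ᵇ ℝ, ‖g‖ ≤ B ∧ ∀ x ∈ K, |f x - g (w x)| ≤ ε := by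
  obtain ⟨g, hg⟩ := exists_continuous_forall_mem_convex_of_local_const
    (t := fun s : ℝ => Icc (-B) B ∩ ⋂ x ∈ K ∩ w ⁻¹' {s}, Metric.closedBall (f x) ε)
    (fun s => (convex_Icc _ _).inter
      (convex_iInter₂ fun x _ => convex_closedBall (f x) ε)) (by
    intro s
    obtain ⟨c, hcB, hc⟩ : ∃ c : ℝ, |c| ≤ B ∧ ∀ x ∈ K, w x = s → |c - f x| < ε := by
      by_cases hs : ∃ x ∈ K, w x = s
      · obtain ⟨x, hx, rfl⟩ := hs
        exact ⟨f x, hf x, fun y hy hxy => h x hx y hy hxy.symm⟩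
      · push Not at hs
        exact ⟨0, by simpa using hB, fun x hx hxs => absurd hxs (hs x hx)⟩
    have hfar : IsCompact (K ∩ {x | ε ≤ |c - f x|}) :=
      hK.inter_right (isClosed_le continuous_const (by fun_prop))
    have hs : s ∉ w '' (K ∩ {x | ε ≤ |c - f x|}) := by
      rintro ⟨x, ⟨hx, hxε⟩, rfl⟩
      exact (hc x hx rfl).not_ge hxε
    refine ⟨c, ?_⟩
    filter_upwards [(hfar.image w.continuous).isClosed.isOpen_compl.mem_nhds hs] with s' hs'
    refine ⟨abs_le.mp hcB, mem_iInter₂.mpr ?_⟩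
    rintro x ⟨hx, rfl⟩
    by_contra! hcx
    rw [Metric.mem_closedBall, Real.dist_eq, not_le] at hcx
    exact hs' ⟨x, ⟨hx, hcx.le⟩, rfl⟩)
  refine ⟨BoundedContinuousFunction.ofNormedAddCommGroup g g.continuous B
    fun s => abs_le.mpr (hg s).1,
    BoundedContinuousFunction.norm_ofNormedAddCommGroup_le _ hB _, fun x hx => ?_⟩
  have := mem_iInter₂.mp (hg (w x)).2 x ⟨hx, rfl⟩
  rwa [Metric.mem_closedBall, Real.dist_eq, abs_sub_comm] at this

/-- A continuous staircase: constant on `[k + 1 / M, k + 1]` for every integer `k`. -/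
noncomputable def staircase (M : ℕ) (z : ℝ) : ℝ := z - (Int.fract z - min 1 (M * Int.fract z))

theorem continuous_staircase {M : ℕ} (hM : 1 ≤ M) : Continuous (staircase M) := by
  have hM' : (1 : ℝ) ≤ M := by exact_mod_cast hM
  refine continuous_id.sub (ContinuousOn.comp_fract'' (f := fun t : ℝ => t - min 1 (M * t)) ?_ ?_)
  · fun_prop
  · simp [hM']

theorem abs_staircase_sub_le (M : ℕ) (z : ℝ) : |staircase M z - z| ≤ 1 := by
  have h0 := Int.fract_nonneg z
  have h1 := (Int.fract_lt_one z).le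
  have h2 : 0 ≤ min 1 (M * Int.fract z) := by positivity
  have h3 := min_le_left 1 (M * Int.fract z)
  rw [staircase, abs_le]
  constructor <;> linarith

theorem fract_of_staircase_notMem_range_intCast {M : ℕ} {z : ℝ}
    (hz : staircase M z ∉ range ((↑) : ℤ → ℝ)) : 0 < M * Int.fract z ∧ M * Int.fract z < 1 := by
  have h : staircase M z = ⌊z⌋ + min 1 (M * Int.fract z) := by
    rw [staircase, Int.fract]; ring
  constructor
  · by_contra! h0
    have : M * Int.fract z = 0 := le_antisymm h0 (by positivity)
    exact hz ⟨⌊z⌋, by simp [h, this]⟩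
  · by_contra! h1
    exact hz ⟨⌊z⌋ + 1, by simp [h, h1]⟩

theorem eq_of_staircase_notMem_range_intCast {M : ℕ} (s : ℝ) {m m' : Fin M}
    (hm : staircase M (s - m / M) ∉ range ((↑) : ℤ → ℝ))
    (hm' : staircase M (s - m' / M) ∉ range ((↑) : ℤ → ℝ)) : m = m' := by
  obtain ⟨h0, h1⟩ := fract_of_staircase_notMem_range_intCast hm
  obtain ⟨h0', h1'⟩ := fract_of_staircase_notMem_range_intCast hm'
  have hM : (M : ℝ) ≠ 0 := by exact_mod_cast (Fin.pos m).ne'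
  set k := ⌊s - m / M⌋ with hk
  set k' := ⌊s - m' / M⌋ with hk'
  have e : (M : ℝ) * Int.fract (s - m / M) = M * s - m - M * k := by
    rw [Int.fract, ← hk]; field_simp
  have e' : (M : ℝ) * Int.fract (s - m' / M) = M * s - m' - M * k' := by
    rw [Int.fract, ← hk']; field_simp
  rw [e] at h0 h1
  rw [e'] at h0' h1'
  have l1 : ((m : ℤ) + M * k) < (m' + M * k') + 1 := by
    rify; linarith
  have l2 : ((m' : ℤ) + M * k') < (m + M * k) + 1 := by
    rify; linarith
  have hmod : (m : ℤ) + M * k = m' + M * k' := by omega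
  have hlt : (m : ℤ) < M := by exact_mod_cast m.2
  have hlt' : (m' : ℤ) < M := by exact_mod_cast m'.2
  have := congrArg (· % (M : ℤ)) hmod
  simp only [Int.add_mul_emod_self_left] at this
  rw [Int.emod_eq_of_lt (by positivity) hlt, Int.emod_eq_of_lt (by positivity) hlt'] at this
  exact Fin.ext (by exact_mod_cast this)

/-- Adding a small generic multiple of an injective function makes any function on a finite type
injective. -/
theorem exists_small_mul_add_injective {ι : Type*} [Finite ι] (S L : ι → ℝ)
    (hL : Function.Injective L) {δ : ℝ} (hδ : 0 < δ) :
    ∃ θ ∈ Ioo 0 δ, Function.Injective fun p => S p + θ * L p := by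
  have hbad : (range fun p : ι × ι => (S p.2 - S p.1) / (L p.1 - L p.2)).Finite := finite_range _
  obtain ⟨θ, hθ, hθ'⟩ := ((Ioo_infinite hδ).sdiff hbad).nonempty
  refine ⟨θ, hθ, fun p q hpq => ?_⟩
  by_contra hne
  have hL' : L p - L q ≠ 0 := sub_ne_zero.mpr (hL.ne hne)
  refine hθ' ⟨(p, q), ?_⟩
  simp only at hpq ⊢
  rw [div_eq_iff hL']
  linarith

theorem exists_perturbation_separating_integer_levels {N : ℕ} (w : Fin N → C(I, ℝ)) {ε : ℝ}
    (hε : 0 < ε) :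
    ∃ n₀ : ℕ, ∀ n : ℕ, n₀ ≤ n → ∀ ρ : C(I, ℝ), (∀ t, |ρ t - n * t| ≤ 2) →
      ∃ w' : Fin N → C(I, ℝ), dist w' w < ε ∧
        ∀ x y : Fin N → I, (∀ i, ρ (x i) ∈ range ((↑) : ℤ → ℝ)) →
          (∀ i, ρ (y i) ∈ range ((↑) : ℤ → ℝ)) →
          ∑ i, w' i (x i) = ∑ i, w' i (y i) → ∀ i, ρ (x i) = ρ (y i) := by
  obtain ⟨d₀, hd₀, hwd⟩ := Metric.uniformContinuous_iff.mp
    (CompactSpace.uniformContinuous_of_continuous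
      (f := fun (t : I) i => w i t) (by fun_prop)) (ε / 3) (by positivity)
  obtain ⟨n₀, hn₀⟩ := exists_nat_gt (2 / d₀)
  refine ⟨n₀, fun n hn ρ hρ => ?_⟩
  have hnd : 2 / d₀ < n := hn₀.trans_le (by exact_mod_cast hn)
  have hn0 : (0 : ℝ) < n := lt_trans (by positivity) hnd
  let a : Fin N → ℝ → ℝ := fun i r => w i (projIcc 0 1 zero_le_one (r / n))
  have ha : ∀ i t, |a i (ρ t) - w i t| < ε / 3 := by
    intro i t
    rw [← Real.dist_eq]
    refine (dist_pi_lt_iff (by positivity)).mp (hwd ?_) i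
    have h1 : dist (projIcc (0 : ℝ) 1 zero_le_one (ρ t / n)) t ≤ |ρ t / n - t| := by
      have := (LipschitzWith.projIcc (zero_le_one' ℝ)).dist_le_mul (ρ t / n) t
      rwa [projIcc_val, NNReal.coe_one, one_mul] at this
    have h2 : |ρ t / n - t| = |ρ t - n * t| / n := by
      rw [← abs_of_pos hn0, ← abs_div, abs_of_pos hn0]
      congr 1; field_simp
    calc _ ≤ |ρ t - n * t| / n := h1.trans_eq h2
      _ ≤ 2 / n := by gcongr; exact hρ t
      _ < d₀ := by rw [div_lt_iff₀ hd₀] at hnd; rw [div_lt_iff₀ hn0]; linarith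
  let b : ℕ := n + 5
  let L : (Fin N → Fin b) → ℝ := fun p => ∑ i, (p i : ℝ) * (b : ℝ) ^ (i : ℕ)
  have hL : Function.Injective L := by
    intro p q hpq
    apply finFunctionFinEquiv.injective
    apply Fin.ext
    rw [finFunctionFinEquiv_apply, finFunctionFinEquiv_apply]
    simp only [L] at hpq
    exact_mod_cast hpq
  obtain ⟨θ, ⟨hθ0, hθ⟩, hinj⟩ := exists_small_mul_add_injective
    (fun p : Fin N → Fin b => ∑ i, a i ((p i : ℝ) - 2)) L hL
    (δ := ε / (3 * (b * (b : ℝ) ^ N))) (by positivity)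
  have hρ0 : ∀ t, 0 ≤ ρ t + 2 ∧ ρ t + 2 < b := by
    intro t
    have := abs_le.mp (hρ t)
    have h1 : n * (t : ℝ) ≤ n := mul_le_of_le_one_right hn0.le t.2.2
    have h0 : 0 ≤ n * (t : ℝ) := mul_nonneg hn0.le t.2.1
    simp only [b]; push_cast
    constructor <;> linarith
  have hb1 : (1 : ℝ) ≤ b := by simp only [b]; push_cast; linarith
  refine ⟨fun i => ⟨fun t => a i (ρ t) + θ * ((ρ t + 2) * (b : ℝ) ^ (i : ℕ)), ?_⟩, ?_, ?_⟩
  · have := (w i).continuous.comp (continuous_projIcc (h := zero_le_one' ℝ))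
    have h2 : Continuous fun t => ρ t / n := by fun_prop
    exact (this.comp h2).add (by fun_prop)
  · refine (dist_pi_lt_iff hε).mpr fun i => (ContinuousMap.dist_lt_iff hε).mpr fun t => ?_
    have h1 := ha i t
    have h2 : θ * ((ρ t + 2) * (b : ℝ) ^ (i : ℕ)) ≤ ε / 3 := by
      calc _ ≤ ε / (3 * (b * (b : ℝ) ^ N)) * (b * (b : ℝ) ^ N) := by
            have := (hρ0 t).1
            have := (hρ0 t).2.le
            have : (i : ℕ) ≤ N := i.2.le
            gcongr
        _ = ε / 3 := by field_simp
    have h3 : 0 ≤ θ * ((ρ t + 2) * (b : ℝ) ^ (i : ℕ)) := by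
      have := (hρ0 t).1
      positivity
    rw [Real.dist_eq, ContinuousMap.coe_mk]
    rw [abs_lt] at h1 ⊢
    constructor <;> linarith
  · have hdig : ∀ x : Fin N → I, (∀ i, ρ (x i) ∈ range ((↑) : ℤ → ℝ)) →
        ∃ p : Fin N → Fin b, ∀ i, ρ (x i) = (p i : ℝ) - 2 := by
      intro x hx
      choose k hk using hx
      have hk0 : ∀ i, 0 ≤ k i + 2 ∧ k i + 2 < b := fun i => by
        have := hρ0 (x i)
        rw [← hk i] at this
        exact_mod_cast this
      refine ⟨fun i => ⟨(k i + 2).toNat, by have := hk0 i; omega⟩, fun i => ?_⟩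
      have : (((k i + 2).toNat : ℤ) : ℝ) = ((k i + 2 : ℤ) : ℝ) := by
        rw [Int.toNat_of_nonneg (hk0 i).1]
      push_cast at this
      rw [← hk i]
      simp only
      linarith
    intro x y hx hy hxy i
    obtain ⟨p, hp⟩ := hdig x hx
    obtain ⟨q, hq⟩ := hdig y hy
    suffices p = q by rw [hp, hq, this]
    apply hinj
    simpa [hp, hq, L, Finset.mul_sum, Finset.sum_add_distrib] using hxy

/-- The inner sums of `v` separate points at distance at least `h`, within each of the
closed sets `K m`, and each point lies in all but at most `N` of these sets. -/
def IsFinelySeparating {N M : ℕ} (h : ℝ) (v : Fin M → Fin N → C(I, ℝ)) : Prop :=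
  ∃ K : Fin M → Set (Fin N → I), (∀ m, IsClosed (K m)) ∧ (∀ x, {m | x ∉ K m}.ncard ≤ N) ∧
    ∀ m, ∀ x ∈ K m, ∀ y ∈ K m, ∑ i, v m i (x i) = ∑ i, v m i (y i) → dist x y < h

theorem isOpen_setOf_isFinelySeparating {N M : ℕ} (h : ℝ) :
    IsOpen {v : Fin M → Fin N → C(I, ℝ) | IsFinelySeparating h v} := by
  refine isOpen_iff_eventually.mpr ?_
  rintro v ⟨K, hK, hcard, hsep⟩
  have hev : ∀ m, ∀ᶠ v' in 𝓝 v, ∀ p ∈ (K m ×ˢ K m) ∩ {p | h ≤ dist p.1 p.2},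
      ∑ i, v' m i (p.1 i) ≠ ∑ i, v' m i (p.2 i) := by
    intro m
    have hcpt : IsCompact ((K m ×ˢ K m) ∩ {p | h ≤ dist p.1 p.2}) :=
      (((hK m).prod (hK m)).inter (isClosed_le continuous_const continuous_dist)).isCompact
    refine hcpt.eventually_forall_of_forall_eventually fun p hp => ?_
    have hopen : IsOpen {z : (Fin M → Fin N → C(I, ℝ)) × ((Fin N → I) × (Fin N → I)) |
        ∑ i, z.1 m i (z.2.1 i) ≠ ∑ i, z.1 m i (z.2.2 i)} :=
      isOpen_ne_fun (by fun_prop) (by fun_prop)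
    exact hopen.mem_nhds fun heq => hp.2.not_gt (hsep m _ hp.1.1 _ hp.1.2 heq)
  filter_upwards [eventually_all.mpr hev] with v' hv'
  refine ⟨K, hK, hcard, fun m x hx y hy hxy => ?_⟩
  by_contra! hd
  exact hv' m (x, y) ⟨⟨hx, hy⟩, hd⟩ hxy

theorem dense_setOf_isFinelySeparating {N M : ℕ} {h : ℝ} (hh : 0 < h) :
    Dense {v : Fin M → Fin N → C(I, ℝ) | IsFinelySeparating h v} := by
  refine Metric.dense_iff.mpr fun v ε hε => ?_
  choose n₀ hn₀ using fun m => exists_perturbation_separating_integer_levels (v m) hε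
  obtain ⟨n₁, hn₁⟩ := exists_nat_gt (4 / h)
  let n : ℕ := Finset.univ.sup n₀ + n₁
  have hn : ∀ m, n₀ m ≤ n := fun m => (Finset.le_sup (Finset.mem_univ m)).trans (by simp [n])
  have hnh : 4 / h < n := hn₁.trans_le (by simp [n])
  have hn0 : (0 : ℝ) < n := lt_trans (by positivity) hnh
  let ρ : Fin M → C(I, ℝ) := fun m =>
    ⟨fun t => staircase M (n * t - m / M), (continuous_staircase (Fin.pos m)).comp (by fun_prop)⟩
  have hρ : ∀ m t, |ρ m t - n * t| ≤ 2 := by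
    intro m t
    have h1 := abs_le.mp (abs_staircase_sub_le M (n * t - m / M))
    have h2 : (m : ℝ) / M ≤ 1 := div_le_one_of_le₀ (by exact_mod_cast m.2.le) (by positivity)
    have h3 : 0 ≤ (m : ℝ) / M := by positivity
    change |staircase M (n * t - m / M) - n * t| ≤ 2
    rw [abs_le]
    constructor <;> linarith
  choose w hw hsep using fun m => hn₀ m n (hn m) (ρ m) (hρ m)
  refine ⟨w, (dist_pi_lt_iff hε).mpr hw,
    fun m => {x | ∀ i, ρ m (x i) ∈ range ((↑) : ℤ → ℝ)}, fun m => ?_, fun x => ?_,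
    fun m x hx y hy hxy => ?_⟩
  · simp only [ofPred_forall]
    exact isClosed_iInter fun i =>
      Int.isClosedEmbedding_coe_real.isClosed_range.preimage (by fun_prop)
  · have hex : ∀ m : {m | x ∉ {x | ∀ i, ρ m (x i) ∈ range ((↑) : ℤ → ℝ)}},
        ∃ i, ρ m (x i) ∉ range ((↑) : ℤ → ℝ) := fun m => not_forall.mp m.2
    choose i hi using hex
    have hinj : Function.Injective i := fun m m' hmm' =>
      Subtype.ext (eq_of_staircase_notMem_range_intCast (n * (x (i m) : ℝ)) (hi m)
        (by rw [hmm']; exact hi m'))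
    simpa using Nat.card_le_card_of_injective i hinj
  · refine (dist_pi_lt_iff hh).mpr fun i => ?_
    have he := hsep m x y hx hy hxy i
    have hx' := abs_le.mp (hρ m (x i))
    have hy' := abs_le.mp (hρ m (y i))
    rw [div_lt_iff₀ hh] at hnh
    rw [Subtype.dist_eq, Real.dist_eq, abs_lt]
    constructor <;> nlinarith

theorem exists_forall_isFinelySeparating (N M : ℕ) :
    ∃ v : Fin M → Fin N → C(I, ℝ), ∀ h > 0, IsFinelySeparating h v := by
  have baire (V : Type) [MetricSpace V] [CompleteSpace V] : BaireSpace V := inferInstance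
  have := baire (Fin M → Fin N → C(I, ℝ))
  obtain ⟨v, hv⟩ := (dense_iInter_of_isOpen_nat
    (f := fun k : ℕ => {v : Fin M → Fin N → C(I, ℝ) | IsFinelySeparating (1 / ((k : ℝ) + 1)) v})
    (fun k => isOpen_setOf_isFinelySeparating _)
    fun k => dense_setOf_isFinelySeparating (by positivity)).nonempty
  refine ⟨v, fun h hh => ?_⟩
  obtain ⟨k, hk⟩ := exists_nat_one_div_lt hh
  obtain ⟨K, hK, hcard, hsep⟩ := mem_iInter.mp hv k
  exact ⟨K, hK, hcard, fun m x hx y hy hxy => (hsep m x hx y hy hxy).trans hk⟩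

/-- The superposition with fixed inner functions `v` and variable outer functions. -/
noncomputable def superposition {N M : ℕ} (v : Fin M → Fin N → C(I, ℝ)) :
    (Fin M → ℝ →ᵇ ℝ) →+ C(Fin N → I, ℝ) where
  toFun u := ⟨fun x => ∑ m, u m (∑ i, v m i (x i)), by fun_prop⟩
  map_zero' := by ext; simp
  map_add' u u' := by ext; simp [Finset.sum_add_distrib]

theorem continuous_superposition {N M : ℕ} (v : Fin M → Fin N → C(I, ℝ)) :
    Continuous (superposition v) := by
  refine AddMonoidHomClass.continuous_of_bound (superposition v) M fun u => ?_
  refine (ContinuousMap.norm_le _ (by positivity)).mpr fun x => ?_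
  calc ‖∑ m, u m (∑ i, v m i (x i))‖ ≤ ∑ m : Fin M, ‖u‖ :=
        norm_sum_le_of_le _ fun m _ => ((u m).norm_coe_le_norm _).trans (norm_le_pi_norm u m)
    _ = M * ‖u‖ := by simp

theorem exists_norm_sub_superposition_le {N M : ℕ} (hM : 4 * N ≤ M) (hM1 : 1 ≤ M)
    {v : Fin M → Fin N → C(I, ℝ)} (hv : ∀ h > 0, IsFinelySeparating h v) (f : C(Fin N → I, ℝ)) :
    ∃ u : Fin M → ℝ →ᵇ ℝ, ‖u‖ ≤ ‖f‖ ∧ ‖f - superposition v u‖ ≤ 3 / 4 * ‖f‖ := by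
  rcases eq_or_ne f 0 with rfl | hf
  · exact ⟨0, by simp⟩
  have hf0 : 0 < ‖f‖ := norm_pos_iff.mpr hf
  have hM0 : (1 : ℝ) ≤ M := by exact_mod_cast hM1
  obtain ⟨h, hh, hfh⟩ := Metric.uniformContinuous_iff.mp
    (CompactSpace.uniformContinuous_of_continuous f.continuous) (‖f‖ / 4) (by positivity)
  obtain ⟨K, hK, hcard, hsep⟩ := hv h hh
  have happrox : ∀ m, ∃ g : ℝ →ᵇ ℝ, ‖g‖ ≤ ‖f‖ ∧
      ∀ x ∈ K m, |f x - g (∑ i, v m i (x i))| ≤ ‖f‖ / 4 := fun m =>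
    exists_comp_approx_of_fiber_oscillation_lt (hK m).isCompact
      ⟨fun x => ∑ i, v m i (x i), by fun_prop⟩ f hf0.le f.norm_coe_le_norm
      fun x hx y hy hxy => hfh (hsep m x hx y hy hxy)
  choose g hg hgf using happrox
  refine ⟨fun m => (M : ℝ)⁻¹ • g m, (pi_norm_le_iff_of_nonneg hf0.le).mpr fun m => ?_,
    (ContinuousMap.norm_le _ (by positivity)).mpr fun x => ?_⟩
  · rw [norm_smul, norm_inv, Real.norm_natCast]
    exact (mul_le_of_le_one_left (norm_nonneg _) (inv_le_one_of_one_le₀ hM0)).trans (hg m)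
  · classical
    have hterm : ∀ m, |f x - g m (∑ i, v m i (x i))| ≤
        ‖f‖ / 4 + if x ∉ K m then 2 * ‖f‖ else 0 := by
      intro m
      split_ifs with hx
      · simpa using hgf m x hx
      · have h1 := abs_le.mp (f.norm_coe_le_norm x)
        have h2 := abs_le.mp (((g m).norm_coe_le_norm (∑ i, v m i (x i))).trans (hg m))
        rw [abs_le]
        constructor <;> linarith
    have hbad : ((Finset.univ.filter fun m => x ∉ K m).card : ℝ) ≤ M / 4 := by
      have h1 := hcard x
      rw [ncard_eq_toFinset_card', toFinset_ofPred] at h1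
      rw [le_div_iff₀ (by norm_num)]
      exact_mod_cast (by omega : (Finset.univ.filter fun m => x ∉ K m).card * 4 ≤ M)
    have hsum : (f - superposition v fun m => (M : ℝ)⁻¹ • g m) x =
        (M : ℝ)⁻¹ * ∑ m, (f x - g m (∑ i, v m i (x i))) := by
      have : (M : ℝ) ≠ 0 := by positivity
      simp [superposition, Finset.mul_sum, mul_sub, this]
    rw [hsum, Real.norm_eq_abs, abs_mul, abs_of_nonneg (by positivity),
      inv_mul_le_iff₀ (by positivity)]
    calc |∑ m, (f x - g m (∑ i, v m i (x i)))|
        ≤ ∑ m, (‖f‖ / 4 + if x ∉ K m then 2 * ‖f‖ else 0) :=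
          (Finset.abs_sum_le_sum_abs _ _).trans (Finset.sum_le_sum fun m _ => hterm m)
      _ = M * (‖f‖ / 4) + (Finset.univ.filter fun m => x ∉ K m).card * (2 * ‖f‖) := by
          rw [Finset.sum_add_distrib, ← Finset.sum_filter]; simp
      _ ≤ M * (‖f‖ / 4) + M / 4 * (2 * ‖f‖) := by gcongr
      _ = M * (3 / 4 * ‖f‖) := by ring

/-- A continuous additive map from a complete group which approximately hits every vector, with
controlled norm and relative error `q < 1`, is surjective. -/
theorem surjective_of_approx_preimage {E F : Type*} [NormedAddCommGroup E] [CompleteSpace E]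
    [NormedAddCommGroup F] (T : E →+ F) (hT : Continuous T) {q : ℝ} (hq0 : 0 ≤ q) (hq1 : q < 1)
    (h : ∀ y, ∃ x, ‖x‖ ≤ ‖y‖ ∧ ‖y - T x‖ ≤ q * ‖y‖) : Function.Surjective T := by
  intro y
  choose g hg hgT using h
  let r : ℕ → F := fun k => (fun z => z - T (g z))^[k] y
  have hr_succ : ∀ k, r (k + 1) = r k - T (g (r k)) := fun k =>
    Function.iterate_succ_apply' _ _ _
  have hr : ∀ k, ‖r k‖ ≤ ‖y‖ * q ^ k := by
    intro k
    induction k with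
    | zero => simp [r]
    | succ k ih =>
      rw [hr_succ, pow_succ]
      nlinarith [hgT (r k)]
  have hgeom : Summable fun k => ‖y‖ * q ^ k := (summable_geometric_of_lt_one hq0 hq1).mul_left _
  have hsum : Summable fun k => g (r k) :=
    Summable.of_norm_bounded hgeom fun k => (hg (r k)).trans (hr k)
  refine ⟨∑' k, g (r k), ?_⟩
  have hlim := (hsum.hasSum.map T hT).tendsto_sum_nat
  have hpartial : ∀ n, ∑ k ∈ Finset.range n, (T ∘ fun k => g (r k)) k = y - r n := by
    intro n
    induction n with
    | zero => simp [r]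
    | succ n ih => rw [Finset.sum_range_succ, ih, hr_succ, Function.comp_apply]; abel
  have hr0 : Tendsto r atTop (𝓝 0) := squeeze_zero_norm hr hgeom.tendsto_atTop_zero
  simp only [hpartial] at hlim
  exact tendsto_nhds_unique hlim (by simpa using hr0.const_sub y)

/-- Kolmogorov–Arnold representation, existence form: every continuous
function `c : [0,1]^N → ℝ` (N ≥ 1) is a finite superposition of nomographic
functions, i.e. `c a = ∑ m, u m (∑ i, v m i (a i))` for some continuous
outer mappings `u m : ℝ → ℝ` and inner mappings `v m i : [0,1] → ℝ`. -/
theorem kolmogorov_arnold_existence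
    (N : ℕ) (hN : 1 ≤ N)
    (c : (Fin N → Set.Icc (0 : ℝ) 1) → ℝ) (hc : Continuous c) :
    ∃ (M : ℕ), 1 ≤ M ∧
      ∃ (u : Fin M → ℝ → ℝ) (v : Fin M → Fin N → Set.Icc (0 : ℝ) 1 → ℝ),
        (∀ m, Continuous (u m)) ∧
        (∀ m i, Continuous (v m i)) ∧
        (∀ a : Fin N → Set.Icc (0 : ℝ) 1,
          c a = ∑ m : Fin M, u m (∑ i : Fin N, v m i (a i))) := by
  obtain ⟨v, hv⟩ := exists_forall_isFinelySeparating N (4 * N)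
  obtain ⟨u, hu⟩ := surjective_of_approx_preimage (superposition v) (continuous_superposition v)
    (q := 3 / 4) (by norm_num) (by norm_num)
    (exists_norm_sub_superposition_le le_rfl (by omega) hv) ⟨c, hc⟩
  exact ⟨4 * N, by omega, fun m => u m, fun m i => v m i, fun m => (u m).continuous,
    fun m i => (v m i).continuous, fun a => (DFunLike.congr_fun hu a).symm⟩
end

section
/- Kolmogorov–Arnold representation, universality of the inner functions (Theorem 1 of the paper): for every integer N ≥ 1 there exist an integer M ≥ 1 and continuous functions v_{m,i} : [0,1] → ℝ for m = 1,…,M and i = 1,…,N, such that for EVERY continuous function c : [0,1]^N → ℝ there exist continuous functions u_m : ℝ → ℝ (m = 1,…,M) with c(a_1,…,a_N) = ∑_{m=1}^{M} u_m( ∑_{i=1}^{N} v_{m,i}(a_i) ) for all (a_1,…,a_N) ∈ [0,1]^N; that is, the choice of the inner mappings v_{m,i} is independent of c, while only the outer mappings u_m depend on c. -/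
open Set Filter Topology BoundedContinuousFunction
open scoped unitInterval

/-- A continuous map which solves an equation up to a fixed contraction factor, with control of the
approximate solutions, is surjective. -/
theorem AddMonoidHom.surjective_of_approx {E F : Type*} [NormedAddCommGroup E] [CompleteSpace E]
    [NormedAddCommGroup F] (T : E →+ F) (hT : Continuous T) {C θ : ℝ} (hθ₀ : 0 ≤ θ) (hθ : θ < 1)
    (h : ∀ f, ∃ g, ‖g‖ ≤ C * ‖f‖ ∧ ‖f - T g‖ ≤ θ * ‖f‖) : Function.Surjective T := by
  intro f
  choose G hGC hGθ using h
  let r : ℕ → F := fun n => (fun y => y - T (G y))^[n] f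
  have hr_succ (n) : r (n + 1) = r n - T (G (r n)) := Function.iterate_succ_apply' _ _ _
  have hr (n) : ‖r n‖ ≤ θ ^ n * ‖f‖ := by
    induction n with
    | zero => simp [r]
    | succ n ih =>
      rw [hr_succ, pow_succ']
      calc _ ≤ θ * ‖r n‖ := hGθ _
        _ ≤ θ * (θ ^ n * ‖f‖) := by gcongr
        _ = _ := by ring
  have hr0 : Tendsto r atTop (𝓝 0) := by
    refine squeeze_zero_norm hr ?_
    simpa using (tendsto_pow_atTop_nhds_zero_of_lt_one hθ₀ hθ).mul_const ‖f‖
  have hsum : Summable fun n => G (r n) := by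
    refine Summable.of_norm_bounded (g := fun n => |C| * (θ ^ n * ‖f‖))
      (((summable_geometric_of_lt_one hθ₀ hθ).mul_right _).mul_left _) fun n => ?_
    calc _ ≤ C * ‖r n‖ := hGC _
      _ ≤ |C| * ‖r n‖ := by gcongr; exact le_abs_self C
      _ ≤ _ := by gcongr; exact hr n
  refine ⟨∑' n, G (r n), ?_⟩
  have h₁ := (hsum.hasSum.map T hT).tendsto_sum_nat
  have h₂ (n) : ∑ i ∈ Finset.range n, (T ∘ fun n => G (r n)) i = f - r n := by
    induction n with
    | zero => simp [r]
    | succ n ih => rw [Finset.sum_range_succ, ih, hr_succ, Function.comp_apply]; abel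
  simp only [h₂] at h₁
  exact tendsto_nhds_unique h₁ (by simpa using hr0.const_sub f)

/-- Smoothed integer parts with `M` different phases: they nearly determine their argument, and
each point has an integer image in a bounded range under all of them except at most one. -/
theorem exists_smoothed_floor {M : ℕ} (hM : 1 ≤ M) {δ : ℝ} (hδ : 0 < δ) :
    ∃ (B : ℕ) (s : Fin M → C(I, ℝ)) (ρ : C(ℝ, I)),
      (∀ m x, dist (ρ (s m x)) x < δ) ∧
      ∀ x m m', (¬ ∃ j : Fin B, s m x = j) → (¬ ∃ j : Fin B, s m' x = j) → m = m' := by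
  obtain ⟨n, hn⟩ := exists_nat_gt (2 / δ)
  have hn0 : (0 : ℝ) < n := (by positivity : 0 < 2 / δ).trans hn
  have hM' : (1 : ℝ) ≤ M := by exact_mod_cast hM
  let h : ℝ → ℝ := fun u => min u ((M - 1) * (1 - u))
  have hh : Continuous (h ∘ Int.fract) :=
    ContinuousOn.comp_fract'' (by fun_prop) (by simp [h, hM'])
  have hh0 (y : ℝ) : 0 ≤ h (Int.fract y) :=
    le_min (Int.fract_nonneg y)
      (mul_nonneg (by linarith) (by linarith [Int.fract_lt_one y]))
  have hh1 (y : ℝ) : h (Int.fract y) < 1 := (min_le_left _ _).trans_lt (Int.fract_lt_one y)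
  let y : Fin M → I → ℝ := fun m x => n * x + m / M
  have hy (m) : Continuous (y m) := by fun_prop
  let s : Fin M → C(I, ℝ) := fun m =>
    ⟨fun x => y m x - (h ∘ Int.fract) (y m x), (hy m).sub (hh.comp (hy m))⟩
  have hs (m x) : s m x = y m x - h (Int.fract (y m x)) := rfl
  have hm0 (m : Fin M) : (0 : ℝ) ≤ m / M := by positivity
  have hm1 (m : Fin M) : (m : ℝ) / M < 1 := by
    rw [div_lt_one (by linarith)]; exact_mod_cast m.2
  refine ⟨n + 1, s, ⟨fun z => projIcc 0 1 zero_le_one (z / n),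
    continuous_projIcc.comp (by fun_prop)⟩, fun m x => ?_, fun x m m' hm hm' => ?_⟩
  · have h₁ : dist (projIcc (0 : ℝ) 1 zero_le_one (s m x / n)) x ≤ |s m x / n - x| := by
      have := abs_projIcc_sub_projIcc (c := s m x / n) (d := (x : ℝ)) (zero_le_one' ℝ)
      rwa [projIcc_val] at this
    refine h₁.trans_lt ?_
    have h₂ : s m x / n - x = (m / M - h (Int.fract (y m x))) / n := by
      rw [hs]; simp only [y]; field_simp; ring
    rw [h₂, abs_div, abs_of_pos hn0, div_lt_iff₀ hn0]
    rw [div_lt_iff₀ hδ] at hn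
    have := (abs_lt (a := (m : ℝ) / M - h (Int.fract (y m x))) (b := 1)).2
      ⟨by linarith [hm0 m, hh1 (y m x)], by linarith [hm1 m, hh0 (y m x)]⟩
    linarith
  · have key (m : Fin M) (hm : ¬ ∃ j : Fin (n + 1), s m x = j) :
        1 - 1 / M < Int.fract (y m x) := by
      by_contra! hle
      apply hm
      have hy0 : 0 ≤ y m x := add_nonneg (mul_nonneg hn0.le x.2.1) (hm0 m)
      have hy1 : y m x < n + 1 := by
        have := mul_le_mul_of_nonneg_left x.2.2 hn0.le
        simp only [y]; linarith [hm1 m]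
      refine ⟨⟨⌊y m x⌋₊, (Nat.floor_lt hy0).2 (by exact_mod_cast hy1)⟩, ?_⟩
      have : h (Int.fract (y m x)) = Int.fract (y m x) := by
        refine min_eq_left ?_
        have h3 : (M : ℝ) * Int.fract (y m x) ≤ M - 1 := by
          calc _ ≤ (M : ℝ) * (1 - 1 / M) := by gcongr
            _ = _ := by field_simp
        linarith
      rw [hs, this]
      simp only [natCast_floor_eq_intCast_floor hy0]
      exact Int.self_sub_fract _
    have k₁ := key m hm
    have k₂ := key m' hm'
    have l₁ := Int.fract_lt_one (y m x)
    have l₂ := Int.fract_lt_one (y m' x)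
    have e : (m : ℝ) / M - m' / M - (⌊y m x⌋ - ⌊y m' x⌋) = Int.fract (y m x) - Int.fract (y m' x) := by
      simp only [Int.fract, y]; ring
    have e₁ : |(m : ℝ) / M - m' / M - (⌊y m x⌋ - ⌊y m' x⌋)| < 1 / M := by
      rw [e, abs_lt]; constructor <;> linarith
    have e₂ : |(m : ℝ) - m' - M * (⌊y m x⌋ - ⌊y m' x⌋)| < 1 := by
      have : (m : ℝ) - m' - M * (⌊y m x⌋ - ⌊y m' x⌋) =
          M * ((m : ℝ) / M - m' / M - (⌊y m x⌋ - ⌊y m' x⌋)) := by field_simp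
      rw [this, abs_mul, abs_of_pos (by linarith : (0 : ℝ) < M)]
      calc _ < (M : ℝ) * (1 / M) := by gcongr
        _ = 1 := by field_simp
    have e₃ : |(m : ℤ) - m' - M * (⌊y m x⌋ - ⌊y m' x⌋)| < 1 := by exact_mod_cast e₂
    rw [Int.abs_lt_one_iff] at e₃
    have e₄ : (M : ℤ) ∣ (m : ℤ) - m' := ⟨_, sub_eq_zero.1 e₃⟩
    have e₅ := Int.eq_zero_of_abs_lt_dvd e₄ (by
      rw [abs_lt]; constructor <;> have := m.2 <;> have := m'.2 <;> omega)
    ext; omega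

/-- Sums of values indexed by tuples become distinct after a small positional perturbation. -/
theorem exists_injective_sum_perturbation {N B : ℕ} (p : Fin N → Fin B → ℝ) {η : ℝ} (hη : 0 < η) :
    ∃ t ∈ Ioo 0 η, Function.Injective
      fun j : Fin N → Fin B => ∑ i, (p i (j i) + t * ((B : ℝ) ^ (i : ℕ) * j i)) := by
  let P : (Fin N → Fin B) → ℝ := fun j => ∑ i, p i (j i)
  let F : (Fin N → Fin B) → ℝ := fun j => (finFunctionFinEquiv j : ℕ)
  have hF : Function.Injective F :=
    Nat.cast_injective.comp (Fin.val_injective.comp finFunctionFinEquiv.injective)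
  have hPF (t : ℝ) (j : Fin N → Fin B) :
      ∑ i, (p i (j i) + t * ((B : ℝ) ^ (i : ℕ) * j i)) = P j + t * F j := by
    simp only [P, F, finFunctionFinEquiv_apply, Finset.sum_add_distrib, Nat.cast_sum,
      Finset.mul_sum]
    push_cast
    simp only [mul_comm]
  obtain ⟨t, ht, hbad⟩ := ((Ioo_infinite hη).sdiff (finite_range
    fun q : (Fin N → Fin B) × (Fin N → Fin B) => (P q.2 - P q.1) / (F q.1 - F q.2))).nonempty
  refine ⟨t, ht, fun j k hjk => ?_⟩
  by_contra hne
  simp only [hPF] at hjk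
  have : F j - F k ≠ 0 := sub_ne_zero.2 (hF.ne hne)
  exact hbad ⟨(j, k), by simp only; field_simp; linarith⟩

/-- The function `a ↦ ∑ i, w i (a i)` on the cube. -/
def innerSum {N : ℕ} (w : Fin N → C(I, ℝ)) : C(Fin N → I, ℝ) :=
  ∑ i, (w i).comp ⟨fun a => a i, continuous_apply i⟩

theorem innerSum_apply {N : ℕ} (w : Fin N → C(I, ℝ)) (a : Fin N → I) :
    innerSum w a = ∑ i, w i (a i) := by
  simp [innerSum]

theorem continuous_innerSum {N : ℕ} :
    Continuous (innerSum : (Fin N → C(I, ℝ)) → C(Fin N → I, ℝ)) :=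
  continuous_finsetSum _ fun i _ => (ContinuousMap.continuous_precomp _).comp (continuous_apply i)

/-- The inner functions for which `f` is approximated, up to a factor `3 / 4`, by a superposition
with controlled outer functions. -/
def approxSet {N : ℕ} (f : C(Fin N → I, ℝ)) : Set (Fin (4 * N) → Fin N → C(I, ℝ)) :=
  {v | ∃ g : Fin (4 * N) → ℝ →ᵇ ℝ, (∀ m, ‖g m‖ ≤ ‖f‖) ∧
    ‖f - ∑ m, (g m).toContinuousMap.comp (innerSum (v m))‖ < 3 / 4 * ‖f‖}

theorem isOpen_approxSet {N : ℕ} (f : C(Fin N → I, ℝ)) : IsOpen (approxSet f) := by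
  have : approxSet f = ⋃ g ∈ {g : Fin (4 * N) → ℝ →ᵇ ℝ | ∀ m, ‖g m‖ ≤ ‖f‖},
      {v | ‖f - ∑ m, (g m).toContinuousMap.comp (innerSum (v m))‖ < 3 / 4 * ‖f‖} := by
    ext v; simp [approxSet]
  rw [this]
  refine isOpen_biUnion fun g _ => isOpen_lt (continuous_norm.comp ?_) continuous_const
  exact continuous_const.sub <| continuous_finsetSum _ fun m _ =>
    (ContinuousMap.continuous_postcomp _).comp (continuous_innerSum.comp (continuous_apply m))

/-- If all but `N` of the `4 * N` numbers `y m` are close to `x / (4 * N)` and the others are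
no larger than expected, their sum is close to `x`. -/
theorem abs_sub_sum_le {N : ℕ} (hN : 1 ≤ N) {x A : ℝ} {y : Fin (4 * N) → ℝ}
    {bad : Finset (Fin (4 * N))} (hbad : bad.card ≤ N) (hx : |x| ≤ A)
    (hy : ∀ m, |y m| ≤ A / (4 * N)) (hgood : ∀ m ∉ bad, |x / (4 * N) - y m| ≤ A / 8 / (4 * N)) :
    |x - ∑ m, y m| ≤ 5 / 8 * A := by
  have hN' : (0 : ℝ) < N := by exact_mod_cast hN
  have hA : 0 ≤ A := (abs_nonneg x).trans hx
  have e : x - ∑ m, y m = ∑ m, (x / (4 * N) - y m) := by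
    rw [Finset.sum_sub_distrib]; simp; field_simp
  have hterm (m) : |x / (4 * N) - y m| ≤
      A / 8 / (4 * N) + if m ∈ bad then A / (2 * N) else 0 := by
    split_ifs with hm
    · calc _ ≤ |x / (4 * N)| + |y m| := abs_sub _ _
        _ ≤ A / (4 * N) + A / (4 * N) := by
          rw [abs_div, abs_of_pos (by positivity : (0 : ℝ) < 4 * N)]
          gcongr
          exact hy m
        _ = A / (2 * N) := by field_simp; ring
        _ ≤ _ := le_add_of_nonneg_left (by positivity)
    · simpa using hgood m hm
  rw [e]
  calc _ ≤ ∑ m, |x / (4 * N) - y m| := Finset.abs_sum_le_sum_abs _ _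
    _ ≤ ∑ m : Fin (4 * N), (A / 8 / (4 * N) + if m ∈ bad then A / (2 * N) else 0) :=
      Finset.sum_le_sum fun m _ => hterm m
    _ = A / 8 + bad.card * (A / (2 * N)) := by
      rw [Finset.sum_add_distrib, Finset.sum_ite_mem]
      simp; field_simp
    _ ≤ A / 8 + N * (A / (2 * N)) := by gcongr
    _ = 5 / 8 * A := by field_simp; ring

theorem dense_approxSet {N : ℕ} (hN : 1 ≤ N) {f : C(Fin N → I, ℝ)} (hf : f ≠ 0) :
    Dense (approxSet f) := by
  have hN' : (0 : ℝ) < N := by exact_mod_cast hN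
  have hf0 : 0 < ‖f‖ := norm_pos_iff.2 hf
  rw [Metric.dense_iff]
  intro v ε hε
  obtain ⟨δ₁, hδ₁, hfδ⟩ := Metric.uniformContinuous_iff.1
    (CompactSpace.uniformContinuous_of_continuous f.continuous) (‖f‖ / 8) (by positivity)
  have hv : Continuous fun x => (fun m i => v m i x) := by fun_prop
  obtain ⟨δ₂, hδ₂, hvδ⟩ := Metric.uniformContinuous_iff.1
    (CompactSpace.uniformContinuous_of_continuous hv) (ε / 2) (by positivity)
  obtain ⟨B, s, ρ, hρ, hs⟩ := exists_smoothed_floor (M := 4 * N) (by omega) (lt_min hδ₁ hδ₂)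
  have hη (m) : 0 < ε / 2 / (((B : ℝ) + 1) ^ N * ‖s m‖ + 1) := by positivity
  choose t ht hinj using fun m =>
    exists_injective_sum_perturbation (fun i (j : Fin B) => v m i (ρ j)) (hη m)
  let w : Fin (4 * N) → Fin N → C(I, ℝ) := fun m i =>
    (v m i).comp (ρ.comp (s m)) + (t m * (B : ℝ) ^ (i : ℕ)) • s m
  let G (m) (j : Fin N → Fin B) : ℝ :=
    ∑ i, (v m i (ρ (j i)) + t m * ((B : ℝ) ^ (i : ℕ) * j i))
  let φ : (Fin N → Fin B) →ᵇ ℝ := .mkOfCompact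
    ⟨fun j => f (fun i => ρ (j i)) / (4 * N), continuous_of_discreteTopology⟩
  have hφ : ‖φ‖ ≤ ‖f‖ / (4 * N) := by
    refine (BoundedContinuousFunction.norm_le (by positivity)).2 fun j => ?_
    change ‖f (fun i => ρ (j i)) / (4 * N)‖ ≤ _
    rw [norm_div, Real.norm_of_nonneg (by positivity : (0 : ℝ) ≤ 4 * N)]
    gcongr
    exact f.norm_coe_le_norm _
  choose g hgφ hgG using fun m => φ.exists_extension_norm_eq_of_isClosedEmbedding
    (Continuous.isClosedEmbedding (f := G m) continuous_of_discreteTopology (hinj m))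
  have hg (m) : ‖g m‖ ≤ ‖f‖ / (4 * N) := (hgφ m).trans_le hφ
  refine ⟨w, ?_, g, fun m => (hg m).trans (div_le_self hf0.le ?_), ?_⟩
  · rw [Metric.mem_ball, dist_pi_lt_iff hε]
    intro m
    rw [dist_pi_lt_iff hε]
    intro i
    rw [ContinuousMap.dist_lt_iff hε]
    intro x
    have h₁ : dist (v m i (ρ (s m x))) (v m i x) < ε / 2 :=
      (dist_pi_lt_iff (by positivity)).1 ((dist_pi_lt_iff (by positivity)).1
        (hvδ ((hρ m x).trans_le (min_le_right _ _))) m) i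
    have h₂ : |t m * (B : ℝ) ^ (i : ℕ) * s m x| < ε / 2 := by
      have hp : (B : ℝ) ^ (i : ℕ) ≤ (B + 1) ^ N := by
        calc _ ≤ ((B : ℝ) + 1) ^ (i : ℕ) := by gcongr; linarith
          _ ≤ _ := pow_le_pow_right₀ (by linarith [(Nat.cast_nonneg B : (0 : ℝ) ≤ B)]) i.2.le
      rw [abs_mul, abs_of_nonneg (mul_nonneg (ht m).1.le (by positivity))]
      have hsx : |s m x| ≤ ‖s m‖ := (s m).norm_coe_le_norm x
      have ht0 := (ht m).1
      have ht1 := (ht m).2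
      rw [lt_div_iff₀ (by positivity)] at ht1
      calc _ ≤ t m * (B + 1) ^ N * ‖s m‖ := by gcongr
        _ < ε / 2 := by nlinarith
    change |v m i (ρ (s m x)) + t m * (B : ℝ) ^ (i : ℕ) * s m x - v m i x| < ε
    rw [Real.dist_eq, abs_lt] at h₁
    rw [abs_lt] at h₂ ⊢
    constructor <;> linarith
  · have : (1 : ℝ) ≤ N := by exact_mod_cast hN
    linarith
  · refine lt_of_le_of_lt ((ContinuousMap.norm_le _ (by positivity)).2 fun a => ?_)
      (by linarith : 5 / 8 * ‖f‖ < 3 / 4 * ‖f‖)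
    classical
    let bad : Finset (Fin (4 * N)) := Finset.univ.biUnion fun i =>
      {m | ¬ ∃ j : Fin B, s m (a i) = j}
    have hbad : bad.card ≤ N := by
      refine (Finset.card_biUnion_le_card_mul _ _ 1 fun i _ => ?_).trans (by simp)
      refine Finset.card_le_one.2 fun m hm m' hm' => hs (a i) m m' ?_ ?_
      · simpa using hm
      · simpa using hm'
    simp only [ContinuousMap.sub_apply, ContinuousMap.sum_apply, Real.norm_eq_abs]
    refine abs_sub_sum_le hN hbad (f.norm_coe_le_norm a)
      (fun m => ((g m).norm_coe_le_norm _).trans (hg m)) fun m hm => ?_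
    have hm' : ∀ i, ∃ j : Fin B, s m (a i) = j := by simpa [bad] using hm
    choose j hj using hm'
    have e₁ : innerSum (w m) a = G m j := by
      rw [innerSum_apply]
      refine Finset.sum_congr rfl fun i _ => ?_
      change v m i (ρ (s m (a i))) + t m * (B : ℝ) ^ (i : ℕ) * s m (a i) = _
      rw [hj, mul_assoc]
    have e₂ : (g m).toContinuousMap.comp (innerSum (w m)) a = f (fun i => ρ (j i)) / (4 * N) := by
      change g m (innerSum (w m) a) = _
      rw [e₁]
      exact congrFun (hgG m) j
    rw [e₂, ← sub_div, abs_div, abs_of_pos (by positivity : (0 : ℝ) < 4 * N)]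
    gcongr
    refine (hfδ ((dist_pi_lt_iff hδ₁).2 fun i => ?_)).le
    rw [dist_comm, ← hj]
    exact (hρ m (a i)).trans_le (min_le_left _ _)

/-- Generic inner functions approximate every function on the cube simultaneously. -/
theorem exists_forall_approx {N : ℕ} (hN : 1 ≤ N) :
    ∃ v : Fin (4 * N) → Fin N → C(I, ℝ), ∀ f : C(Fin N → I, ℝ), ∃ g : Fin (4 * N) → ℝ →ᵇ ℝ,
      ‖g‖ ≤ 2 * ‖f‖ ∧
      ‖f - ∑ m, (g m).toContinuousMap.comp (innerSum (v m))‖ ≤ 7 / 8 * ‖f‖ := by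
  obtain ⟨S, hSc, hSd⟩ := TopologicalSpace.exists_countable_dense C(Fin N → I, ℝ)
  have : BaireSpace (Fin (4 * N) → Fin N → C(I, ℝ)) :=
    BaireSpace.of_completelyPseudoMetrizable
  obtain ⟨v, hv⟩ := (dense_biInter_of_isOpen (S := S \ {0}) (fun f _ => isOpen_approxSet f)
    (hSc.mono sdiff_subset) fun f hf => dense_approxSet hN hf.2).nonempty
  refine ⟨v, fun f => ?_⟩
  rcases eq_or_ne f 0 with rfl | hf
  · refine ⟨0, by simp, ?_⟩
    have : ∀ m, (0 : ℝ →ᵇ ℝ).toContinuousMap.comp (innerSum (v m)) = 0 := fun m => rfl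
    simp [this]
  have hf0 : 0 < ‖f‖ := norm_pos_iff.2 hf
  obtain ⟨h, hhS, hh⟩ := hSd.exists_dist_lt f (by positivity : 0 < ‖f‖ / 16)
  rw [dist_eq_norm] at hh
  have hh₁ : ‖h‖ ≤ 17 / 16 * ‖f‖ := by
    have := norm_sub_norm_le h f
    rw [norm_sub_rev] at this
    linarith
  have hh₀ : h ≠ 0 := by
    rintro rfl
    rw [sub_zero] at hh
    linarith
  obtain ⟨g, hg, hgh⟩ := mem_iInter₂.1 hv h ⟨hhS, hh₀⟩
  refine ⟨g, (pi_norm_le_iff_of_nonneg (by positivity)).2 fun m => (hg m).trans (by linarith), ?_⟩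
  have := norm_add_le (f - h) (h - ∑ m, (g m).toContinuousMap.comp (innerSum (v m)))
  rw [sub_add_sub_cancel] at this
  linarith

/-- Kolmogorov–Arnold representation, universality of the inner functions:
for every `N ≥ 1` there exist `M ≥ 1` and continuous inner mappings
`v m i : [0,1] → ℝ` such that every continuous `c : [0,1]^N → ℝ` can be
written as `c a = ∑ m, u m (∑ i, v m i (a i))` for some continuous outer
mappings `u m : ℝ → ℝ` depending on `c`. -/
theorem kolmogorov_arnold_universal_inner
    (N : ℕ) (hN : 1 ≤ N) :
    ∃ (M : ℕ), 1 ≤ M ∧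
      ∃ (v : Fin M → Fin N → Set.Icc (0 : ℝ) 1 → ℝ),
        (∀ m i, Continuous (v m i)) ∧
        ∀ (c : (Fin N → Set.Icc (0 : ℝ) 1) → ℝ), Continuous c →
          ∃ (u : Fin M → ℝ → ℝ),
            (∀ m, Continuous (u m)) ∧
            (∀ a : Fin N → Set.Icc (0 : ℝ) 1,
              c a = ∑ m : Fin M, u m (∑ i : Fin N, v m i (a i))) := by
  obtain ⟨v, hv⟩ := exists_forall_approx hN
  refine ⟨4 * N, by omega, fun m i => v m i, fun m i => (v m i).continuous, fun c hc => ?_⟩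
  let T : (Fin (4 * N) → ℝ →ᵇ ℝ) →+ C(Fin N → I, ℝ) :=
    { toFun := fun g => ∑ m, (g m).toContinuousMap.comp (innerSum (v m))
      map_zero' := Finset.sum_eq_zero fun m _ => rfl
      map_add' := fun g h => by
        rw [← Finset.sum_add_distrib]
        exact Finset.sum_congr rfl fun m _ => rfl }
  have hT : Continuous T := by
    refine AddMonoidHomClass.continuous_of_bound T (4 * N) fun g => ?_
    calc _ ≤ ∑ m, ‖(g m).toContinuousMap.comp (innerSum (v m))‖ := norm_sum_le _ _
      _ ≤ ∑ _m : Fin (4 * N), ‖g‖ := Finset.sum_le_sum fun m _ =>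
        (ContinuousMap.norm_le _ (norm_nonneg g)).2 fun a =>
          ((g m).norm_coe_le_norm _).trans (norm_le_pi_norm g m)
      _ = 4 * N * ‖g‖ := by simp
  obtain ⟨g, hg⟩ := T.surjective_of_approx hT (by norm_num) (by norm_num) hv ⟨c, hc⟩
  refine ⟨fun m => g m, fun m => (g m).continuous, fun a => ?_⟩
  have := DFunLike.congr_fun hg a
  simp only [ContinuousMap.coe_mk] at this
  rw [← this]
  change (∑ m, (g m).toContinuousMap.comp (innerSum (v m))) a = _
  rw [ContinuousMap.sum_apply]
  refine Finset.sum_congr rfl fun m _ => ?_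
  rw [← innerSum_apply]
  rfl
end

section
/- Every function of N real variables on the unit cube is nomographic (Buck's representability result used in the paper): for every integer N ≥ 1 and every function c : [0,1]^N → ℝ (no continuity assumed), there exist a function u : ℝ → ℝ and functions v_i : [0,1] → ℝ for i = 1,…,N such that c(a_1,…,a_N) = u( ∑_{i=1}^{N} v_i(a_i) ) for all (a_1,…,a_N) ∈ [0,1]^N. -/
/-- As a rational vector space, `ℝⁿ` is isomorphic to `ℝ` for every nonempty finite index type. -/
theorem nonempty_pi_real_linearEquiv_real (ι : Type) [Fintype ι] [Nonempty ι] :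
    Nonempty ((ι → ℝ) ≃ₗ[ℚ] ℝ) := by
  apply nonempty_linearEquiv_of_rank_eq
  rw [rank_fun, Real.rank_rat_real]
  exact Cardinal.nat_mul_continuum Fintype.card_ne_zero


/-- Buck's representability result: every function `c : [0,1]^N → ℝ`
(N ≥ 1, no continuity assumed) is nomographic, i.e.
`c a = u (∑ i, v i (a i))` for some `u : ℝ → ℝ` and `v i : [0,1] → ℝ`. -/
theorem every_function_is_nomographic
    (N : ℕ) (hN : 1 ≤ N)
    (c : (Fin N → Set.Icc (0 : ℝ) 1) → ℝ) :
    ∃ (u : ℝ → ℝ) (v : Fin N → Set.Icc (0 : ℝ) 1 → ℝ),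
      ∀ a : Fin N → Set.Icc (0 : ℝ) 1,
        c a = u (∑ i : Fin N, v i (a i)) := by
 
  have : Nonempty (Fin N) := ⟨⟨0, hN⟩⟩
  obtain ⟨φ⟩ := nonempty_pi_real_linearEquiv_real (Fin N)
  have hφ (a : Fin N → Set.Icc (0 : ℝ) 1) :
      ∑ i, φ (Pi.single i (a i : ℝ)) = φ fun i => a i := by
    rw [← map_sum, Finset.univ_sum_single]
  refine ⟨fun y => c fun i => Set.projIcc 0 1 zero_le_one (φ.symm y i),
    fun i x => φ (Pi.single i (x : ℝ)), fun a => ?_⟩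
  simp only [hφ, LinearEquiv.symm_apply_apply, Set.projIcc_val]
end

section
/- Continuously nomographic functions are nowhere dense (the result of Buck cited by the paper to show that the factorization with continuous mappings is in general invalid): the set of all functions c in C([0,1]×[0,1], ℝ) for which there exist continuous functions u : ℝ → ℝ and v_1, v_2 : [0,1] → ℝ with c(a_1,a_2) = u(v_1(a_1) + v_2(a_2)) for all (a_1,a_2) ∈ [0,1]×[0,1], is nowhere dense in C([0,1]×[0,1], ℝ) equipped with the supremum-norm topology. -/
/-- If `u (f x + g y)` takes disjoint sets of values for `x = p` and for `x = q`, with `y` ranging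
over the interval from `a` to `b`, then `f` varies more between `p` and `q` than `g` does between
`a` and `b`. -/
lemma abs_sub_lt_abs_sub_of_forall_ne {X Y : Type*} [TopologicalSpace Y] {S : Set Y}
    (hS : IsPreconnected S) {u : ℝ → ℝ} {f : X → ℝ} {g : Y → ℝ} (hg : Continuous g)
    {p q : X} {a b : Y} (ha : a ∈ S) (hb : b ∈ S)
    (h : ∀ y ∈ S, ∀ y' ∈ S, u (f p + g y) ≠ u (f q + g y')) :
    |g a - g b| < |f p - f q| := by
  by_contra! hle
  wlog hab : g a ≤ g b generalizing a b
  · exact this hb ha (by rwa [abs_sub_comm (g b)]) (le_of_not_ge hab)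
  have hsub := hS.intermediate_value ha hb hg.continuousOn
  rw [abs_of_nonpos (sub_nonpos.2 hab), abs_le] at hle
  rcases le_total (f q) (f p) with hpq | hpq
  · obtain ⟨y, hy, hgy⟩ := hsub (show g a + (f p - f q) ∈ Set.Icc (g a) (g b) from
      ⟨by linarith, by linarith⟩)
    exact h a ha y hy (by rw [hgy]; ring_nf)
  · obtain ⟨y, hy, hgy⟩ := hsub (show g b + (f p - f q) ∈ Set.Icc (g a) (g b) from
      ⟨by linarith, by linarith⟩)
    exact h b hb y hy (by rw [hgy]; ring_nf)

/-- One side of each corner square of side `s` of the unit square, with direction alternating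
between vertical and horizontal as one goes around the unit square. The chosen sides have
coordinate `l` in the squares along the bottom edge and `r` in the squares along the top edge; `(l, r)` is
meant to be `(0, 1 - s)` or `(s, 1)`. -/
def switchingSides (s l r : ℝ) : Set (Set.Icc (0 : ℝ) 1 × Set.Icc (0 : ℝ) 1) :=
  {a | (a.1 : ℝ) = l ∧ (a.2 : ℝ) ≤ s} ∪ {a | 1 - s ≤ (a.1 : ℝ) ∧ (a.2 : ℝ) = l} ∪
    ({a | (a.1 : ℝ) = r ∧ 1 - s ≤ (a.2 : ℝ)} ∪ {a | (a.1 : ℝ) ≤ s ∧ (a.2 : ℝ) = r})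

lemma isClosed_switchingSides (s l r : ℝ) : IsClosed (switchingSides s l r) := by
  have h₁ : Continuous fun a : Set.Icc (0 : ℝ) 1 × Set.Icc (0 : ℝ) 1 => (a.1 : ℝ) := by fun_prop
  have h₂ : Continuous fun a : Set.Icc (0 : ℝ) 1 × Set.Icc (0 : ℝ) 1 => (a.2 : ℝ) := by fun_prop
  refine .union (.union ?_ ?_) (.union ?_ ?_)
  · exact (isClosed_eq h₁ continuous_const).inter (isClosed_le h₂ continuous_const)
  · exact (isClosed_le continuous_const h₁).inter (isClosed_eq h₂ continuous_const)
  · exact (isClosed_eq h₁ continuous_const).inter (isClosed_le continuous_const h₂)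
  · exact (isClosed_le h₁ continuous_const).inter (isClosed_eq h₂ continuous_const)

lemma disjoint_switchingSides {s : ℝ} (hs : 0 < s) (hs' : s < 1 / 2) :
    Disjoint (switchingSides s 0 (1 - s)) (switchingSides s s 1) := by
  rw [Set.disjoint_left]
  rintro a ((⟨h₁, h₂⟩ | ⟨h₁, h₂⟩) | (⟨h₁, h₂⟩ | ⟨h₁, h₂⟩))
    ((⟨h₃, h₄⟩ | ⟨h₃, h₄⟩) | (⟨h₃, h₄⟩ | ⟨h₃, h₄⟩)) <;> linarith

/-- A function separating nearby points of the two families of sides is not of the form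
`u (v₁ x + v₂ y)`. -/
lemma not_nomographic_of_separates_switchingSides {s δ : ℝ} (hs : 0 < s) (hs' : s < 1 / 2)
    (hsδ : s < δ) {u : ℝ → ℝ} {v₁ v₂ : Set.Icc (0 : ℝ) 1 → ℝ} (hv₁ : Continuous v₁)
    (hv₂ : Continuous v₂)
    (h : ∀ a ∈ switchingSides s 0 (1 - s), ∀ b ∈ switchingSides s s 1, dist a b < δ →
      u (v₁ a.1 + v₂ a.2) ≠ u (v₁ b.1 + v₂ b.2)) : False := by
  let x₀ : Set.Icc (0 : ℝ) 1 := ⟨0, by norm_num⟩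
  let x₁ : Set.Icc (0 : ℝ) 1 := ⟨s, by constructor <;> linarith⟩
  let x₂ : Set.Icc (0 : ℝ) 1 := ⟨1 - s, by constructor <;> linarith⟩
  let x₃ : Set.Icc (0 : ℝ) 1 := ⟨1, by norm_num⟩
  have hlow : IsPreconnected {x : Set.Icc (0 : ℝ) 1 | (x : ℝ) ≤ s} :=
    (Set.ordConnected_Iic (a := x₁)).isPreconnected
  have hupp : IsPreconnected {x : Set.Icc (0 : ℝ) 1 | 1 - s ≤ (x : ℝ)} :=
    (Set.ordConnected_Ici (a := x₂)).isPreconnected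
  have hdist : ∀ x y x' y' : Set.Icc (0 : ℝ) 1, |(x : ℝ) - x'| ≤ s → |(y : ℝ) - y'| ≤ s →
      dist (x, y) (x', y') < δ := fun x y x' y' hx hy =>
    (max_le (by simpa [Subtype.dist_eq, Real.dist_eq] using hx)
      (by simpa [Subtype.dist_eq, Real.dist_eq] using hy)).trans_lt hsδ
  have h₀ : (x₀ : ℝ) = 0 := rfl
  have h₁ : (x₁ : ℝ) = s := rfl
  have h₂ : (x₂ : ℝ) = 1 - s := rfl
  have h₃ : (x₃ : ℝ) = 1 := rfl
  have hA : |v₂ x₀ - v₂ x₁| < |v₁ x₀ - v₁ x₁| := by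
    refine abs_sub_lt_abs_sub_of_forall_ne (u := u) hlow hv₂ (by simp [h₀, hs.le]) (by simp [h₁])
      fun y hy y' hy' => h (x₀, y) (.inl (.inl ⟨h₀, hy⟩)) (x₁, y') (.inl (.inl ⟨h₁, hy'⟩))
        (hdist _ _ _ _ ?_ ?_)
    all_goals
      have := y.2.1; have := y'.2.1
      simp only [Set.mem_ofPred_eq] at hy hy'
      rw [abs_le]; constructor <;> linarith
  have hB : |v₁ x₂ - v₁ x₃| < |v₂ x₀ - v₂ x₁| := by
    refine abs_sub_lt_abs_sub_of_forall_ne (u := u) hupp hv₁ (by simp [h₂]) (by simp [h₃, hs.le])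
      fun y hy y' hy' => ?_
    rw [add_comm, add_comm (v₂ x₁)]
    refine h (y, x₀) (.inl (.inr ⟨hy, h₀⟩)) (y', x₁) (.inl (.inr ⟨hy', h₁⟩))
        (hdist _ _ _ _ ?_ ?_)
    all_goals
      have := y.2.2; have := y'.2.2
      simp only [Set.mem_ofPred_eq] at hy hy'
      rw [abs_le]; constructor <;> linarith
  have hC : |v₂ x₂ - v₂ x₃| < |v₁ x₂ - v₁ x₃| := by
    refine abs_sub_lt_abs_sub_of_forall_ne (u := u) hupp hv₂ (by simp [h₂]) (by simp [h₃, hs.le])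
      fun y hy y' hy' => h (x₂, y) (.inr (.inl ⟨h₂, hy⟩)) (x₃, y') (.inr (.inl ⟨h₃, hy'⟩))
        (hdist _ _ _ _ ?_ ?_)
    all_goals
      have := y.2.2; have := y'.2.2
      simp only [Set.mem_ofPred_eq] at hy hy'
      rw [abs_le]; constructor <;> linarith
  have hD : |v₁ x₀ - v₁ x₁| < |v₂ x₂ - v₂ x₃| := by
    refine abs_sub_lt_abs_sub_of_forall_ne (u := u) hlow hv₁ (by simp [h₀, hs.le]) (by simp [h₁])
      fun y hy y' hy' => ?_
    rw [add_comm, add_comm (v₂ x₃)]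
    refine h (y, x₂) (.inr (.inr ⟨hy, h₂⟩)) (y', x₃) (.inr (.inr ⟨hy', h₃⟩))
        (hdist _ _ _ _ ?_ ?_)
    all_goals
      have := y.2.1; have := y'.2.1
      simp only [Set.mem_ofPred_eq] at hy hy'
      rw [abs_le]; constructor <;> linarith
  linarith

/-- Buck's result: the set of continuously nomographic functions
`c (a₁, a₂) = u (v₁ a₁ + v₂ a₂)` (with `u, v₁, v₂` continuous) is nowhere
dense in `C([0,1] × [0,1], ℝ)` with the supremum-norm (compact-open)
topology. -/
theorem continuously_nomographic_nowhere_dense :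
    IsNowhereDense
      {c : C(Set.Icc (0 : ℝ) 1 × Set.Icc (0 : ℝ) 1, ℝ) |
        ∃ (u : ℝ → ℝ) (v₁ v₂ : Set.Icc (0 : ℝ) 1 → ℝ),
          Continuous u ∧ Continuous v₁ ∧ Continuous v₂ ∧
          ∀ a : Set.Icc (0 : ℝ) 1 × Set.Icc (0 : ℝ) 1,
            c a = u (v₁ a.1 + v₂ a.2)} := by
  rw [IsNowhereDense, Set.eq_empty_iff_forall_notMem]
  intro c hc
  obtain ⟨ε, hε, hball⟩ := Metric.mem_nhds_iff.1 (mem_interior_iff_mem_nhds.1 hc)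
  obtain ⟨δ, hδ, hcδ⟩ := Metric.uniformContinuous_iff.1
    (CompactSpace.uniformContinuous_of_continuous c.continuous) (ε / 8) (by positivity)
  obtain ⟨s, hs, hsm⟩ := exists_between (lt_min hδ (show (0 : ℝ) < 1 / 2 by norm_num))
  obtain ⟨hsδ, hs'⟩ := lt_min_iff.1 hsm
  obtain ⟨φ, hφ₀, hφ₁, hφ⟩ := exists_continuous_zero_one_of_isClosed
    (isClosed_switchingSides s 0 (1 - s)) (isClosed_switchingSides s s 1)
    (disjoint_switchingSides hs hs')
  have hmem : c + (ε / 2) • φ ∈ Metric.ball c ε := by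
    rw [Metric.mem_ball]
    refine ((ContinuousMap.dist_le (half_pos hε).le).2 fun a => ?_).trans_lt (half_lt_self hε)
    have := hφ a
    rw [Real.dist_eq, abs_le]
    simp only [ContinuousMap.add_apply, ContinuousMap.smul_apply, smul_eq_mul]
    constructor <;> nlinarith [this.1, this.2]
  obtain ⟨d, ⟨u, v₁, v₂, -, hv₁, hv₂, hd⟩, hdist⟩ :=
    Metric.mem_closure_iff.1 (hball hmem) (ε / 8) (by positivity)
  refine not_nomographic_of_separates_switchingSides hs hs' hsδ hv₁ hv₂ (u := u)
    fun a ha b hb hab heq => ?_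
  rw [← hd a, ← hd b] at heq
  have h₁ := hcδ hab
  have h₂ := (ContinuousMap.dist_apply_le_dist a).trans_lt hdist
  have h₃ := (ContinuousMap.dist_apply_le_dist b).trans_lt hdist
  have h₄ : φ a = 0 := hφ₀ ha
  have h₅ : φ b = 1 := hφ₁ hb
  simp only [Real.dist_eq, abs_lt, ContinuousMap.add_apply, ContinuousMap.smul_apply,
    smul_eq_mul, h₄, h₅] at h₁ h₂ h₃
  linarith [h₁.1, h₁.2, h₂.1, h₂.2, h₃.1, h₃.2]
end

section
/- There exists a continuous function c : [0,1]×[0,1] → ℝ that admits no continuous nomographic factorization; that is, there is no triple of continuous functions u : ℝ → ℝ and v_1, v_2 : [0,1] → ℝ satisfying c(a_1,a_2) = u(v_1(a_1) + v_2(a_2)) for all (a_1,a_2) ∈ [0,1]×[0,1]. -/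
/-- The range of a continuous real function on a preconnected space meets its translates by less
than `|f b - f a|`, at a point other than `a`. -/
theorem exists_translate_eq {X : Type*} [TopologicalSpace X] [PreconnectedSpace X] {f : X → ℝ}
    (hf : Continuous f) {a b : X} {d : ℝ} (hd : |d| < |f b - f a|) :
    ∃ x x', x ≠ a ∧ f x + d = f x' := by
  have hba : b ≠ a := by
    rintro rfl
    simp [(abs_nonneg d).not_gt] at hd
  have hrange : Set.uIcc (f a) (f b) ⊆ Set.range f :=
    (isPreconnected_range hf).ordConnected.uIcc_subset ⟨a, rfl⟩ ⟨b, rfl⟩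
  have hmem : f b + d ∈ Set.uIcc (f a) (f b) ∨ f b - d ∈ Set.uIcc (f a) (f b) := by
    simp only [Set.mem_uIcc]
    grind
  rcases hmem with hmem | hmem
  · obtain ⟨x', hx'⟩ := hrange hmem
    exact ⟨b, x', hba, hx'.symm⟩
  · obtain ⟨x, hx⟩ := hrange hmem
    refine ⟨x, b, ?_, by linarith⟩
    rintro rfl
    rw [hx, sub_sub_cancel] at hd
    exact lt_irrefl _ hd

/-- There exists a continuous function `c : [0,1] × [0,1] → ℝ` that admits
no continuous nomographic factorization `c (a₁, a₂) = u (v₁ a₁ + v₂ a₂)`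
with `u : ℝ → ℝ` and `v₁, v₂ : [0,1] → ℝ` continuous. -/
theorem exists_continuous_not_nomographic :
    ∃ c : Set.Icc (0 : ℝ) 1 × Set.Icc (0 : ℝ) 1 → ℝ,
      Continuous c ∧
      ¬ ∃ (u : ℝ → ℝ) (v₁ v₂ : Set.Icc (0 : ℝ) 1 → ℝ),
          Continuous u ∧ Continuous v₁ ∧ Continuous v₂ ∧
          ∀ a : Set.Icc (0 : ℝ) 1 × Set.Icc (0 : ℝ) 1,
            c a = u (v₁ a.1 + v₂ a.2) := by
  refine ⟨fun a => (a.1 : ℝ) * a.2, by fun_prop, ?_⟩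
  rintro ⟨u, v₁, v₂, -, hv₁, hv₂, h⟩
  have hne : v₁ 0 ≠ v₁ 1 := by
    intro heq
    have h₀ := h (0, 1)
    have h₁ := h (1, 1)
    simp only [heq] at h₀
    rw [← h₁] at h₀
    norm_num at h₀
  -- On the edge `a₂ = 0` the product vanishes, and a nearby section overlaps that edge.
  obtain ⟨y, hy, hd⟩ : ∃ y : Set.Icc (0 : ℝ) 1, 0 < (y : ℝ) ∧
      |v₂ y - v₂ 0| < |v₁ 1 - v₁ 0| := by
    obtain ⟨ε, hε, hball⟩ := Metric.continuous_iff.mp hv₂ 0 _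
      (abs_pos.mpr (sub_ne_zero.mpr hne.symm))
    have hm : 0 < min (ε / 2) 1 := by positivity
    refine ⟨⟨min (ε / 2) 1, hm.le, min_le_right _ _⟩, hm, ?_⟩
    rw [← Real.dist_eq (v₂ _)]
    apply hball
    rw [Subtype.dist_eq, Real.dist_eq]
    have : min (ε / 2) 1 ≤ ε / 2 := min_le_left _ _
    simp only [Set.Icc.coe_zero, sub_zero, abs_of_pos hm]
    linarith
  obtain ⟨x, x', hx, hxx'⟩ := exists_translate_eq hv₁ hd
  have hxy : (x : ℝ) * y = 0 := by
    refine (h (x, y)).trans ?_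
    rw [show v₁ x + v₂ y = v₁ x' + v₂ 0 by linarith, ← h (x', 0)]
    simp
  rcases mul_eq_zero.mp hxy with h₀ | h₀
  · exact hx (Subtype.ext h₀)
  · exact hy.ne' h₀
end

section
/- Exactness of the proposed edge-cloud architecture over invertible channels: let N ≥ 1 and S ≥ 1 be integers and for each i = 1,…,N let h_i : ℝ^S → ℝ^S be a homeomorphism (the effective channel map). Then for every continuous function c : [0,1]^N → ℝ there exist an integer M ≥ 1, continuous encoder functions f_i : [0,1] → ℝ^S for i = 1,…,N, continuous branch functions z_m : ℝ^S → ℝ for m = 1,…,M, and continuous outer functions u_m : ℝ → ℝ for m = 1,…,M, such that c(a_1,…,a_N) = ∑_{m=1}^{M} u_m( ∑_{i=1}^{N} z_m( h_i( f_i(a_i) ) ) ) for all (a_1,…,a_N) ∈ [0,1]^N. Note that the branch functions z_m are shared across all indices i. -/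
open Set Topology BoundedContinuousFunction

/-- A continuous function agreeing with the floor away from the last `1 / M` of each unit interval. -/
lemma exists_continuous_eq_floor {M : ℝ} (hM : 1 ≤ M) :
    ∃ p : C(ℝ, ℝ), (∀ x, |p x - x| ≤ 1) ∧ ∀ x, Int.fract x ≤ 1 - 1 / M → p x = ⌊x⌋ := by
  have hg : Continuous ((fun s : ℝ => min s ((1 - s) * (M - 1))) ∘ Int.fract) := by
    apply ContinuousOn.comp_fract''
    · fun_prop
    · simp [hM]
  refine ⟨⟨fun x => x - min (Int.fract x) ((1 - Int.fract x) * (M - 1)),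
    continuous_id.sub hg⟩, fun x => ?_, fun x hx => ?_⟩
  · have h0 := Int.fract_nonneg x
    have h1 := Int.fract_lt_one x
    have h2 : 0 ≤ (1 - Int.fract x) * (M - 1) := mul_nonneg (by linarith) (by linarith)
    have h3 := min_le_left (Int.fract x) ((1 - Int.fract x) * (M - 1))
    have h4 := le_min h0 h2
    simp only [ContinuousMap.coe_mk]
    rw [abs_le]
    constructor <;> linarith
  · have h1 : Int.fract x ≤ (1 - Int.fract x) * (M - 1) := by
      have h2 : 1 / M * M = 1 := by field_simp
      nlinarith
    simp only [ContinuousMap.coe_mk]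
    rw [min_eq_left h1, Int.self_sub_fract]

/-- Among the shifts of `y` by multiples of `1 / M`, at most one has its fractional part
in the last `1 / M` of the unit interval. -/
lemma eq_of_lt_fract_add_div {M : ℕ} (y : ℝ) (m m' : Fin M)
    (hm : 1 - 1 / (M : ℝ) < Int.fract (y + m / M))
    (hm' : 1 - 1 / (M : ℝ) < Int.fract (y + m' / M)) : m = m' := by
  have hM : 0 < M := m.pos
  have hM' : (0 : ℝ) < M := by exact_mod_cast hM
  have e := Int.floor_add_fract (y + (m : ℝ) / M)
  have e' := Int.floor_add_fract (y + (m' : ℝ) / M)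
  have l := Int.fract_lt_one (y + (m : ℝ) / M)
  have l' := Int.fract_lt_one (y + (m' : ℝ) / M)
  set a := ⌊y + (m : ℝ) / M⌋
  set b := ⌊y + (m' : ℝ) / M⌋
  set s := Int.fract (y + (m : ℝ) / M)
  set s' := Int.fract (y + (m' : ℝ) / M)
  have key : ((m : ℝ) - m') - M * ((a : ℝ) - b) = M * (s - s') := by
    have h1 : ((m : ℝ) / M - m' / M) = (a - b) + (s - s') := by linarith
    have h2 : ((m : ℝ) / M - m' / M) * M = (m : ℝ) - m' := by field_simp
    rw [← h2, h1]; ring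
  have h1M : 1 / (M : ℝ) * M = 1 := by field_simp
  have u1 : ((m : ℝ) - m') - M * ((a : ℝ) - b) < 1 := by rw [key]; nlinarith
  have u2 : -1 < ((m : ℝ) - m') - M * ((a : ℝ) - b) := by rw [key]; nlinarith
  have v1 : ((m : ℤ) - m') - M * (a - b) < 1 := by exact_mod_cast u1
  have v2 : -1 < ((m : ℤ) - m') - M * (a - b) := by exact_mod_cast u2
  have v : ((m : ℤ) - m') = M * (a - b) := by omega
  have hz : ((m : ℤ) - m') = 0 := by
    apply Int.eq_zero_of_abs_lt_dvd ⟨_, v⟩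
    rw [abs_lt]
    have := m.isLt
    have := m'.isLt
    constructor <;> omega
  ext
  omega

/-- A small multiple of an injective function makes a finite family of functions injective. -/
lemma exists_small_mul_add_injective_s5 {ι κ : Type*} [Finite ι] [Finite κ]
    (F : ι → κ → ℝ) {w : κ → ℝ} (hw : Function.Injective w) {η : ℝ} (hη : 0 < η) :
    ∃ t ∈ Ioo 0 η, ∀ m, Function.Injective fun j => F m j + t * w j := by
  have hfin : (⋃ q : ι × κ × κ, {t : ℝ | q.2.1 ≠ q.2.2 ∧
      F q.1 q.2.1 + t * w q.2.1 = F q.1 q.2.2 + t * w q.2.2}).Finite := by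
    refine finite_iUnion fun q => Set.Subsingleton.finite ?_
    rintro t ⟨hne, ht⟩ t' ⟨-, ht'⟩
    have h1 : (t - t') * (w q.2.1 - w q.2.2) = 0 := by linarith
    rcases mul_eq_zero.1 h1 with h | h
    · linarith
    · exact absurd (hw (sub_eq_zero.1 h)) hne
  obtain ⟨t, ht, hnt⟩ := ((Ioo_infinite hη).sdiff hfin).nonempty
  refine ⟨t, ht, fun m j j' hj => ?_⟩
  by_contra hne
  exact hnt (mem_iUnion.2 ⟨(m, j, j'), hne, hj⟩)

lemma exists_separation_of_injective {ι κ : Type*} [Finite ι] [Finite κ]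
    (F : ι → κ → ℝ) (hF : ∀ m, Function.Injective (F m)) :
    ∃ δ > 0, ∀ m j j', |F m j - F m j'| < δ → j = j' := by
  have : ∀ᶠ δ in 𝓝[>] (0 : ℝ), ∀ q : ι × κ × κ, |F q.1 q.2.1 - F q.1 q.2.2| < δ → q.2.1 = q.2.2 := by
    rw [Filter.eventually_all]
    rintro ⟨m, j, j'⟩
    by_cases hj : j = j'
    · exact Filter.Eventually.of_forall fun _ _ => hj
    · have : 0 < |F m j - F m j'| := abs_pos.2 (sub_ne_zero.2 fun h => hj (hF m h))
      filter_upwards [Ioo_mem_nhdsGT this] with δ hδ h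
      exact absurd h (not_lt.2 hδ.2.le)
  obtain ⟨δ, h, hδ⟩ := (this.and self_mem_nhdsWithin).exists
  exact ⟨δ, hδ, fun m j j' => h (m, j, j')⟩

/-- The sums `∑ i, ψ m i (x i)` separate, with a uniform gap, points at distance at least `r` of
the cubes `(K m)^N`, where every point of `[0,1]` lies in all `K m` but at most one. -/
def SeparatesAtScale {M N : ℕ} (r : ℝ) (ψ : Fin M → Fin N → C(Icc (0 : ℝ) 1, ℝ)) : Prop :=
  ∃ K : Fin M → Set (Icc (0 : ℝ) 1), (∀ x m m', x ∉ K m → x ∉ K m' → m = m') ∧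
    ∃ δ > 0, ∀ m, ∀ x y : Fin N → Icc (0 : ℝ) 1, (∀ i, x i ∈ K m) → (∀ i, y i ∈ K m) →
      |∑ i, ψ m i (x i) - ∑ i, ψ m i (y i)| < δ → dist x y < r

lemma abs_sum_sub_sum_le_mul_dist {M N : ℕ} (ψ φ : Fin M → Fin N → C(Icc (0 : ℝ) 1, ℝ))
    (m : Fin M) (x : Fin N → Icc (0 : ℝ) 1) :
    |∑ i, ψ m i (x i) - ∑ i, φ m i (x i)| ≤ N * dist ψ φ := by
  rw [← Finset.sum_sub_distrib]
  refine (Finset.abs_sum_le_sum_abs _ _).trans ?_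
  refine (Finset.sum_le_card_nsmul _ _ (dist ψ φ) fun i _ => ?_).trans (by simp)
  rw [← Real.dist_eq]
  exact (ContinuousMap.dist_apply_le_dist (x i)).trans
    ((dist_le_pi_dist (ψ m) (φ m) i).trans (dist_le_pi_dist ψ φ m))

lemma isOpen_separatesAtScale {M N : ℕ} (r : ℝ) :
    IsOpen {ψ : Fin M → Fin N → C(Icc (0 : ℝ) 1, ℝ) | SeparatesAtScale r ψ} := by
  rw [Metric.isOpen_iff]
  rintro ψ ⟨K, hK, δ, hδ, h⟩
  refine ⟨δ / (4 * (N + 1)), by positivity, fun φ hφ => ⟨K, hK, δ / 2, by positivity, ?_⟩⟩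
  intro m x y hx hy hxy
  refine h m x y hx hy ?_
  rw [Metric.mem_ball, lt_div_iff₀ (by positivity)] at hφ
  have h0 : 0 ≤ dist φ ψ := dist_nonneg
  have h1 := abs_le.1 (abs_sum_sub_sum_le_mul_dist φ ψ m x)
  have h2 := abs_le.1 (abs_sum_sub_sum_le_mul_dist φ ψ m y)
  rw [abs_lt] at hxy ⊢
  constructor <;> nlinarith

lemma dense_separatesAtScale {M N : ℕ} {r : ℝ} (hr : 0 < r) :
    Dense {ψ : Fin M → Fin N → C(Icc (0 : ℝ) 1, ℝ) | SeparatesAtScale r ψ} := by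
  rw [Metric.dense_iff]
  intro ψ ε hε
  rcases Nat.eq_zero_or_pos M with rfl | hM
  · exact ⟨ψ, Metric.mem_ball_self hε, fun _ => univ, fun x m => m.elim0, 1, one_pos,
      fun m => m.elim0⟩
  have hM1 : (1 : ℝ) ≤ M := by exact_mod_cast hM
  obtain ⟨p, hp, hpK⟩ := exists_continuous_eq_floor hM1
  have huc : UniformContinuous fun (x : Icc (0 : ℝ) 1) (m : Fin M) (i : Fin N) => ψ m i x :=
    CompactSpace.uniformContinuous_of_continuous (by fun_prop)
  obtain ⟨ρ, hρ, hψ⟩ := Metric.uniformContinuous_iff.1 huc (ε / 4) (by positivity)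
  obtain ⟨J, hJ⟩ := exists_nat_gt (max (1 / r) (2 / ρ))
  have hJr : 1 / r < J := (le_max_left _ _).trans_lt hJ
  have hJρ : 2 / ρ < J := (le_max_right _ _).trans_lt hJ
  have hJ0 : (0 : ℝ) < J := (by positivity : 0 < 1 / r).trans hJr
  rw [div_lt_iff₀ hr] at hJr
  rw [div_lt_iff₀ hρ] at hJρ
  set B := J + 2 with hB
  let y : Fin M → Icc (0 : ℝ) 1 → ℝ := fun m x => x * J + m / M
  have hmM : ∀ m : Fin M, 0 ≤ (m : ℝ) / M ∧ (m : ℝ) / M < 1 := fun m =>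
    ⟨by positivity, by rw [div_lt_one (by positivity)]; exact_mod_cast m.isLt⟩
  have hy : ∀ m x, 0 ≤ y m x ∧ y m x < J + 1 := fun m x => by
    have := hmM m
    have h0 := x.2.1
    have h1 := x.2.2
    constructor
    · have := mul_nonneg h0 hJ0.le
      simp only [y]; linarith
    · have := mul_le_mul_of_nonneg_right h1 hJ0.le
      simp only [y]; linarith
  let K : Fin M → Set (Icc (0 : ℝ) 1) := fun m => {x | Int.fract (y m x) ≤ 1 - 1 / M}
  let cl : ℝ → Icc (0 : ℝ) 1 := fun s => projIcc 0 1 zero_le_one (s / J)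
  have hcl : ∀ m x, dist (cl (p (y m x))) x < ρ := fun m x => by
    have h1 : dist (cl (p (y m x))) x ≤ dist (p (y m x) / J) x := by
      conv_lhs => rw [← projIcc_val zero_le_one x]
      simpa using (LipschitzWith.projIcc (zero_le_one' ℝ)).dist_le_mul (p (y m x) / J) x
    refine h1.trans_lt ?_
    have h2 : p (y m x) / J - x = ((p (y m x) - y m x) + m / M) / J := by
      simp only [y]; field_simp; ring
    rw [Real.dist_eq, h2, abs_div, abs_of_pos hJ0, div_lt_iff₀ hJ0]
    have := abs_le.1 (hp (y m x))
    have := hmM m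
    refine lt_of_le_of_lt (b := 2) ?_ (by linarith)
    rw [abs_le]; constructor <;> linarith
  let code : (Fin N → Fin B) → ℝ := fun j => ((finFunctionFinEquiv j : ℕ) : ℝ)
  have hcode : Function.Injective code := fun j j' h =>
    finFunctionFinEquiv.injective (Fin.ext (Nat.cast_injective h))
  let F : Fin M → (Fin N → Fin B) → ℝ := fun m j => ∑ i, ψ m i (cl (j i : ℕ))
  have hB0 : (0 : ℝ) < (B : ℝ) := by positivity
  obtain ⟨t, ht, hinj⟩ := exists_small_mul_add_injective_s5 F hcode
    (show 0 < ε / (4 * ((B : ℝ) ^ N * B)) by positivity)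
  obtain ⟨δ, hδ, hsep⟩ := exists_separation_of_injective _ hinj
  have hyc : ∀ m, Continuous (y m) := fun m => by fun_prop
  have hclc : Continuous cl := continuous_projIcc.comp (by fun_prop)
  let φ : Fin M → Fin N → C(Icc (0 : ℝ) 1, ℝ) := fun m i =>
    ⟨fun x => ψ m i (cl (p (y m x))) + t * (p (y m x) * B ^ (i : ℕ)), by
      have := hyc m
      fun_prop⟩
  refine ⟨φ, ?_, K, ?_, δ, hδ, ?_⟩
  · rw [Metric.mem_ball]
    refine lt_of_le_of_lt (b := ε / 2) ?_ (by linarith)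
    have hε2 : 0 ≤ ε / 2 := by positivity
    have hε4 : 0 < ε / 4 := by positivity
    refine (dist_pi_le_iff hε2).2 fun m => (dist_pi_le_iff hε2).2 fun i =>
      (ContinuousMap.dist_le hε2).2 fun x => ?_
    have h1 : dist (ψ m i (cl (p (y m x)))) (ψ m i x) < ε / 4 :=
      (dist_pi_lt_iff hε4).1 ((dist_pi_lt_iff hε4).1 (hψ (hcl m x)) m) i
    have h2 : |t * (p (y m x) * B ^ (i : ℕ))| ≤ ε / 4 := by
      have hp' : |p (y m x)| ≤ B := by
        have := abs_le.1 (hp (y m x))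
        have := hy m x
        rw [hB]; push_cast
        rw [abs_le]; constructor <;> linarith
      have hB1 : (1 : ℝ) ≤ B := by rw [hB]; push_cast; linarith
      have hBi : (B : ℝ) ^ (i : ℕ) ≤ B ^ N := pow_le_pow_right₀ hB1 i.isLt.le
      have ht' := ht.2.le
      rw [le_div_iff₀ (by positivity)] at ht'
      rw [abs_mul, abs_mul, abs_of_pos ht.1, abs_of_pos (pow_pos hB0 _)]
      have h3 : |p (y m x)| * (B : ℝ) ^ (i : ℕ) ≤ B * B ^ N := by gcongr
      have h4 := mul_le_mul_of_nonneg_left h3 ht.1.le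
      linarith
    rw [Real.dist_eq] at h1 ⊢
    have h3 : φ m i x - ψ m i x =
        (ψ m i (cl (p (y m x))) - ψ m i x) + t * (p (y m x) * B ^ (i : ℕ)) := by
      simp only [φ, ContinuousMap.coe_mk]; ring
    rw [h3]
    refine (abs_add_le _ _).trans ?_
    linarith
  · intro x m m' hm hm'
    exact eq_of_lt_fract_add_div (x * J) m m' (not_le.1 hm) (not_le.1 hm')
  · intro m x x' hx hx' hxx'
    have hfl : ∀ x, ⌊y m x⌋₊ < B := fun x => by
      rw [Nat.floor_lt (hy m x).1, hB]; push_cast; linarith [(hy m x).2]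
    have hpf : ∀ x ∈ K m, p (y m x) = (⌊y m x⌋₊ : ℝ) := fun x hx => by
      rw [hpK _ hx, natCast_floor_eq_intCast_floor (hy m x).1]
    let j : (Fin N → Icc (0 : ℝ) 1) → Fin N → Fin B := fun x i => ⟨⌊y m (x i)⌋₊, hfl (x i)⟩
    have hsum : ∀ x : Fin N → Icc (0 : ℝ) 1, (∀ i, x i ∈ K m) →
        ∑ i, φ m i (x i) = F m (j x) + t * code (j x) := fun x hx => by
      simp only [φ, F, code, j, ContinuousMap.coe_mk, Finset.sum_add_distrib,
        finFunctionFinEquiv_apply, Finset.mul_sum, Nat.cast_sum, Nat.cast_mul, Nat.cast_pow]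
      simp only [hpf _ (hx _)]
    rw [hsum x hx, hsum x' hx'] at hxx'
    have hj := hsep m _ _ hxx'
    rw [dist_pi_lt_iff hr]
    intro i
    have hji : ⌊y m (x i)⌋₊ = ⌊y m (x' i)⌋₊ := congrArg Fin.val (congrFun hj i)
    have a1 := Nat.floor_le (hy m (x i)).1
    have a2 := Nat.lt_floor_add_one (y m (x i))
    have b1 := Nat.floor_le (hy m (x' i)).1
    have b2 := Nat.lt_floor_add_one (y m (x' i))
    rw [hji] at a1 a2
    have hlt : |y m (x i) - y m (x' i)| < 1 := by rw [abs_lt]; constructor <;> linarith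
    have he : y m (x i) - y m (x' i) = ((x i : ℝ) - x' i) * J := by simp only [y]; ring
    rw [he, abs_mul, abs_of_pos hJ0] at hlt
    rw [Subtype.dist_eq, Real.dist_eq]
    have : |(x i : ℝ) - x' i| * J < r * J := by linarith
    exact lt_of_mul_lt_mul_right this hJ0.le

lemma exists_forall_separatesAtScale (M N : ℕ) :
    ∃ ψ : Fin M → Fin N → C(Icc (0 : ℝ) 1, ℝ), ∀ r > 0, SeparatesAtScale r ψ := by
  have : BaireSpace (Fin M → Fin N → C(Icc (0 : ℝ) 1, ℝ)) :=
    BaireSpace.of_completelyPseudoMetrizable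
  obtain ⟨ψ, hψ⟩ := (dense_iInter_of_isOpen_nat
    (f := fun n : ℕ => {ψ : Fin M → Fin N → C(Icc (0 : ℝ) 1, ℝ) | SeparatesAtScale (1 / (n + 1)) ψ})
    (fun n => isOpen_separatesAtScale _)
    (fun n => dense_separatesAtScale (by positivity))).nonempty
  refine ⟨ψ, fun r hr => ?_⟩
  obtain ⟨n, hn⟩ := exists_nat_one_div_lt hr
  obtain ⟨K, hK, δ, hδ, h⟩ := mem_iInter.1 hψ n
  exact ⟨K, hK, δ, hδ, fun m x y hx hy hxy => (h m x y hx hy hxy).trans hn⟩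

/-- If `Ψ` separates points of `K` where `f` differs by at least `e`, then on `K` the function `f`
is within `e` of a bounded continuous function of `Ψ`. -/
lemma exists_boundedContinuous_comp_near {X : Type*} {K : Set X} {Ψ f : X → ℝ} {δ e C : ℝ}
    (hδ : 0 < δ) (hC : 0 ≤ C) (hf : ∀ x, |f x| ≤ C)
    (h : ∀ x ∈ K, ∀ y ∈ K, |Ψ x - Ψ y| < δ → |f x - f y| ≤ e) :
    ∃ u : ℝ →ᵇ ℝ, ‖u‖ ≤ C ∧ ∀ x ∈ K, |u (Ψ x) - f x| ≤ e := by
  obtain ⟨g, hg⟩ := exists_continuous_forall_mem_convex_of_local_const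
    (t := fun s : ℝ => Icc (-C) C ∩ ⋂ x ∈ {x ∈ K | Ψ x = s}, Metric.closedBall (f x) e)
    (fun s => (convex_Icc _ _).inter (convex_iInter₂ fun x _ => convex_closedBall _ _))
    (fun s => by
      by_cases hs : ∃ x ∈ K, |Ψ x - s| < δ / 2
      · obtain ⟨x, hxK, hx⟩ := hs
        refine ⟨f x, ?_⟩
        filter_upwards [Metric.ball_mem_nhds s (half_pos hδ)] with s' hs'
        refine ⟨abs_le.1 (hf x), mem_iInter₂.2 ?_⟩
        rintro y ⟨hyK, rfl⟩
        rw [Metric.mem_ball, Real.dist_eq] at hs'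
        rw [Metric.mem_closedBall, Real.dist_eq]
        refine h x hxK y hyK ?_
        rw [abs_lt] at *
        constructor <;> linarith
      · refine ⟨0, ?_⟩
        filter_upwards [Metric.ball_mem_nhds s (half_pos hδ)] with s' hs'
        refine ⟨⟨by linarith, hC⟩, mem_iInter₂.2 ?_⟩
        rintro y ⟨hyK, rfl⟩
        exact absurd ⟨y, hyK, hs'⟩ hs)
  have hgC : ∀ s, ‖g s‖ ≤ C := fun s => abs_le.2 (hg s).1
  refine ⟨BoundedContinuousFunction.ofNormedAddCommGroup g g.continuous C hgC,
    BoundedContinuousFunction.norm_ofNormedAddCommGroup_le g.continuous hC hgC, fun x hx => ?_⟩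
  have := mem_iInter₂.1 (hg (Ψ x)).2 x ⟨hx, rfl⟩
  rwa [Metric.mem_closedBall, Real.dist_eq] at this

/-- One approximation step: a continuous function on the cube is represented up to a fixed
fraction of its norm. -/
lemma exists_superposition_near {N : ℕ} {ψ : Fin (2 * N + 1) → Fin N → C(Icc (0 : ℝ) 1, ℝ)}
    (hψ : ∀ r > 0, SeparatesAtScale r ψ) (f : C(Fin N → Icc (0 : ℝ) 1, ℝ)) :
    ∃ u : Fin (2 * N + 1) → ℝ →ᵇ ℝ, ‖u‖ ≤ ‖f‖ ∧
      ∀ x, |f x - ∑ m, u m (∑ i, ψ m i (x i))| ≤ (1 - 1 / (2 * (2 * N + 1))) * ‖f‖ := by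
  rcases eq_or_ne f 0 with rfl | hf0
  · exact ⟨0, by simp, by simp⟩
  have hF : 0 < ‖f‖ := norm_pos_iff.2 hf0
  set M : ℝ := 2 * N + 1 with hMdef
  have hM : 0 < M := by positivity
  have hM1 : 1 ≤ M := le_add_of_nonneg_left (by positivity)
  set e : ℝ := ‖f‖ / (2 * M) with he
  have he0 : 0 < e := by positivity
  obtain ⟨r, hr, hfr⟩ := Metric.uniformContinuous_iff.1
    (CompactSpace.uniformContinuous_of_continuous f.continuous) e he0
  obtain ⟨K, hK, δ, hδ, h⟩ := hψ r hr
  have hu : ∀ m, ∃ u : ℝ →ᵇ ℝ, ‖u‖ ≤ ‖f‖ / M ∧ ∀ x ∈ {x : Fin N → Icc (0 : ℝ) 1 | ∀ i, x i ∈ K m},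
      |u (∑ i, ψ m i (x i)) - f x / M| ≤ e / M := fun m => by
    refine exists_boundedContinuous_comp_near (Ψ := fun x => ∑ i, ψ m i (x i))
      (f := fun x => f x / M) hδ (by positivity) (fun x => ?_) fun x hx y hy hxy => ?_
    · rw [abs_div, abs_of_pos hM]
      gcongr
      exact f.norm_coe_le_norm x
    · rw [← sub_div, abs_div, abs_of_pos hM]
      gcongr
      exact (hfr (h m x y hx hy hxy)).le
  choose u hu1 hu2 using hu
  refine ⟨u, (pi_norm_le_iff_of_nonneg hF.le).2 fun m =>
    (hu1 m).trans (div_le_self hF.le hM1), fun x => ?_⟩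
  classical
  let bad : Finset (Fin (2 * N + 1)) := {m | ∃ i, x i ∉ K m}
  have hbad : bad.card ≤ N := by
    have hex : ∀ m : bad, ∃ i, x i ∉ K m := fun m => (Finset.mem_filter.1 m.2).2
    choose g hg using hex
    have hginj : Function.Injective g := fun m m' hmm => by
      refine Subtype.ext (hK (x (g m)) m m' (hg m) ?_)
      rw [hmm]; exact hg m'
    simpa using Fintype.card_le_of_injective g hginj
  have hterm : ∀ m, |f x / M - u m (∑ i, ψ m i (x i))| ≤
      e / M + if m ∈ bad then 2 * (‖f‖ / M) else 0 := fun m => by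
    split_ifs with hm
    · have h1 : |f x / M| ≤ ‖f‖ / M := by
        rw [abs_div, abs_of_pos hM]
        gcongr
        exact f.norm_coe_le_norm x
      have h2 : |u m (∑ i, ψ m i (x i))| ≤ ‖f‖ / M := ((u m).norm_coe_le_norm _).trans (hu1 m)
      have h3 : 0 ≤ e / M := by positivity
      exact (abs_sub _ _).trans (by linarith)
    · rw [abs_sub_comm, add_zero]
      refine hu2 m x fun i => ?_
      by_contra hi
      exact hm (Finset.mem_filter.2 ⟨Finset.mem_univ _, i, hi⟩)
  have hcard : ((2 * N + 1 : ℕ) : ℝ) = M := by rw [hMdef]; push_cast; ring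
  have hfx : f x = ∑ _m : Fin (2 * N + 1), f x / M := by
    rw [Finset.sum_const, Finset.card_univ, Fintype.card_fin, nsmul_eq_mul, hcard]
    field_simp
  rw [hfx, ← Finset.sum_sub_distrib]
  refine ((Finset.abs_sum_le_sum_abs _ _).trans (Finset.sum_le_sum fun m _ => hterm m)).trans ?_
  rw [Finset.sum_add_distrib, Finset.sum_const, Finset.card_univ, Fintype.card_fin, nsmul_eq_mul,
    hcard, Finset.sum_ite_mem, Finset.univ_inter, Finset.sum_const, nsmul_eq_mul]
  have hbad' : (bad.card : ℝ) ≤ N := by exact_mod_cast hbad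
  calc M * (e / M) + bad.card * (2 * (‖f‖ / M))
      ≤ M * (e / M) + N * (2 * (‖f‖ / M)) := by gcongr
    _ = (1 - 1 / (2 * M)) * ‖f‖ := by
      have hN : (N : ℝ) = (M - 1) / 2 := by rw [hMdef]; ring
      rw [he, hN]
      field_simp
      ring

/-- The **Kolmogorov–Arnold superposition theorem** for `2 * N + 1` inner families depending only
on the number of variables. -/
theorem exists_kolmogorov_arnold (N : ℕ) :
    ∃ ψ : Fin (2 * N + 1) → Fin N → C(Icc (0 : ℝ) 1, ℝ),
      ∀ f : C(Fin N → Icc (0 : ℝ) 1, ℝ), ∃ u : Fin (2 * N + 1) → ℝ →ᵇ ℝ,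
        ∀ x, f x = ∑ m, u m (∑ i, ψ m i (x i)) := by
  obtain ⟨ψ, hψ⟩ := exists_forall_separatesAtScale (2 * N + 1) N
  refine ⟨ψ, fun f => ?_⟩
  choose U hU1 hU2 using exists_superposition_near hψ
  set θ : ℝ := 1 - 1 / (2 * (2 * N + 1)) with hθ
  have hθ1 : θ < 1 := sub_lt_self _ (by positivity)
  have hθ0 : 0 ≤ θ := by
    rw [hθ, sub_nonneg, div_le_one (by positivity)]
    have : (0 : ℝ) ≤ N := by positivity
    linarith
  let T : C(Fin N → Icc (0 : ℝ) 1, ℝ) → C(Fin N → Icc (0 : ℝ) 1, ℝ) := fun g =>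
    ⟨fun x => g x - ∑ m, U g m (∑ i, ψ m i (x i)), by fun_prop⟩
  let R : ℕ → C(Fin N → Icc (0 : ℝ) 1, ℝ) := fun k => T^[k] f
  have hR1 : ∀ k, R (k + 1) = T (R k) := fun k => Function.iterate_succ_apply' T k f
  have hRn : ∀ k, ‖R k‖ ≤ θ ^ k * ‖f‖ := fun k => by
    induction k with
    | zero => simp [R]
    | succ k ih =>
      rw [hR1]
      calc ‖T (R k)‖ ≤ θ * ‖R k‖ :=
            (ContinuousMap.norm_le _ (by positivity)).2 fun x => hU2 (R k) x
        _ ≤ θ * (θ ^ k * ‖f‖) := by gcongr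
        _ = θ ^ (k + 1) * ‖f‖ := by ring
  have hgeo : Summable fun k => θ ^ k * ‖f‖ :=
    (summable_geometric_of_lt_one hθ0 hθ1).mul_right _
  have hsum : Summable fun k => U (R k) :=
    Summable.of_norm_bounded hgeo fun k => (hU1 (R k)).trans (hRn k)
  refine ⟨∑' k, U (R k), fun x => ?_⟩
  have hpart : ∀ n, ∑ k ∈ Finset.range n, ∑ m, U (R k) m (∑ i, ψ m i (x i)) = f x - R n x :=
    fun n => by
      rw [Finset.sum_congr rfl fun k _ => (show _ = R k x - R (k + 1) x by simp [hR1, T])]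
      exact Finset.sum_range_sub' (fun k => R k x) n
  have hR0 : Filter.Tendsto (fun n => R n x) Filter.atTop (𝓝 0) :=
    squeeze_zero_norm (fun n => ((R n).norm_coe_le_norm x).trans (hRn n))
      hgeo.tendsto_atTop_zero
  have h1 : Filter.Tendsto (fun n => ∑ k ∈ Finset.range n, ∑ m, U (R k) m (∑ i, ψ m i (x i)))
      Filter.atTop (𝓝 (f x)) := by
    simp only [hpart]
    simpa using tendsto_const_nhds.sub hR0
  have h2 : HasSum (fun k => ∑ m, U (R k) m (∑ i, ψ m i (x i)))
      (∑ m, (∑' k, U (R k)) m (∑ i, ψ m i (x i))) :=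
    hasSum_sum fun m _ => (Pi.hasSum.1 hsum.hasSum m).map
      (BoundedContinuousFunction.evalCLM ℝ (∑ i, ψ m i (x i)))
      (BoundedContinuousFunction.evalCLM ℝ (∑ i, ψ m i (x i))).continuous
  exact tendsto_nhds_unique h1 h2.tendsto_sum_nat

/-- Exactness of the proposed edge-cloud architecture over invertible
channels: for homeomorphic channel maps `h i : ℝ^S ≃ₜ ℝ^S`, every continuous
`c : [0,1]^N → ℝ` can be represented as
`c a = ∑ m, u m (∑ i, z m (h i (f i (a i))))` with continuous per-node
encoders `f i : [0,1] → ℝ^S`, shared continuous branch functions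
`z m : ℝ^S → ℝ` and continuous outer functions `u m : ℝ → ℝ`. -/
theorem edge_cloud_architecture_exact
    (N S : ℕ) (hN : 1 ≤ N) (hS : 1 ≤ S)
    (h : Fin N → ((Fin S → ℝ) ≃ₜ (Fin S → ℝ)))
    (c : (Fin N → Set.Icc (0 : ℝ) 1) → ℝ) (hc : Continuous c) :
    ∃ (M : ℕ), 1 ≤ M ∧
      ∃ (f : Fin N → Set.Icc (0 : ℝ) 1 → (Fin S → ℝ))
        (z : Fin M → (Fin S → ℝ) → ℝ)
        (u : Fin M → ℝ → ℝ),
        (∀ i, Continuous (f i)) ∧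
        (∀ m, Continuous (z m)) ∧
        (∀ m, Continuous (u m)) ∧
        (∀ a : Fin N → Set.Icc (0 : ℝ) 1,
          c a = ∑ m : Fin M, u m (∑ i : Fin N, z m (h i (f i (a i))))) := by
  obtain ⟨ψ, hψ⟩ := exists_kolmogorov_arnold N
  obtain ⟨u, hu⟩ := hψ ⟨c, hc⟩
  let e : Fin N × Icc (0 : ℝ) 1 → Fin S → ℝ := fun q _ => q.2 + 2 * (q.1 : ℕ)
  have hec : Continuous e := continuous_pi fun _ => by fun_prop
  have hei : Function.Injective e := by
    rintro ⟨i, a⟩ ⟨j, b⟩ hab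
    have hab : (a : ℝ) + 2 * (i : ℕ) = b + 2 * (j : ℕ) := congrFun hab ⟨0, hS⟩
    obtain ⟨ha0, ha1⟩ := a.2
    obtain ⟨hb0, hb1⟩ := b.2
    have h1 : (i : ℕ) < (j : ℕ) + 1 := by
      have : ((i : ℕ) : ℝ) < (j : ℕ) + 1 := by linarith
      exact_mod_cast this
    have h2 : (j : ℕ) < (i : ℕ) + 1 := by
      have : ((j : ℕ) : ℝ) < (i : ℕ) + 1 := by linarith
      exact_mod_cast this
    obtain rfl : i = j := Fin.ext (by omega)
    exact Prod.ext rfl (Subtype.ext (by linarith))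
  have hemb := hec.isClosedEmbedding hei
  have hz : ∀ m, ∃ z : C(Fin S → ℝ, ℝ), ∀ i a, z (e (i, a)) = ψ m i a := fun m => by
    obtain ⟨z, hz⟩ := ContinuousMap.exists_extension hemb
      (⟨fun q => ψ m q.1 q.2, continuous_prod_of_discrete_left.2 fun i => (ψ m i).continuous⟩ :
        C(Fin N × Icc (0 : ℝ) 1, ℝ))
    exact ⟨z, fun i a => DFunLike.congr_fun hz (i, a)⟩
  choose z hz using hz
  refine ⟨2 * N + 1, by omega, fun i a => (h i).symm (e (i, a)), fun m => z m, fun m => u m,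
    fun i => (h i).symm.continuous.comp (by fun_prop), fun m => (z m).continuous,
    fun m => (u m).continuous, fun a => ?_⟩
  simpa [hz] using hu a
end
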